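/- arXiv:2009.04336 — 7 statements merged into one kernel-verified Lean document; each statement's English description precedes it below -/
import Mathlib

section
/- Consider a two-player extensive-form game (as in the model below) satisfying perfect recall that is triangle-free, and let d := |Σ₁ ⇌ Σ₂| be the number of relevant sequence pairs. Then there exist n ∈ ℕ, positive integers d₁, …, dₙ with 1 + d₁ + ⋯ + dₙ = d, sets 𝒳₁, …, 𝒳ₙ where each 𝒳ₖ is either the standard probability simplex Δ^{dₖ} ⊆ ℝ^{dₖ} or (with dₖ = 1) the singleton {1} ⊆ ℝ, linear functions hₖ : ℝ^{1+d₁+⋯+d_{k−1}} → ℝ with hₖ nonnegative on 𝒫_{k−1}, and a bijection between the relevant sequence pairs Σ₁ ⇌ Σ₂ and the coordinates of ℝᵈ, such that the image of 𝒱 under the coordinate reindexing induced by this bijection equals 𝒫ₙ, where 𝒫₀ := {1} ⊆ ℝ and 𝒫ₖ := 𝒫_{k−1} ⋉^{hₖ} 𝒳ₖ for k = 1, …, n. -/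
open scoped Classical

/-- The type of "sequences" of a player: `none` is the empty sequence `∅`, and
`some (I, a)` is the sequence consisting of information set `I` (a set of nodes)
together with action `a` at `I`. -/
abbrev SeqP := Option (Set (List ℕ) × ℕ)

/-- The type of (candidate) reduced-normal-form plans: partial functions from
information sets to actions, encoded with `Option`. -/
abbrev PlanT := Set (List ℕ) → Option ℕ

/-- Two information sets (of the two players) are connected, `I ⇌ J`, if some node
of one is a prefix of some node of the other. -/
def Connected (I J : Set (List ℕ)) : Prop := ∃ u ∈ I, ∃ v ∈ J, u <+: v ∨ v <+: u

/-- A two-player extensive-form game.  Nodes are histories (finite lists of naturals),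
`H` is the finite, prefix-closed set of nodes.  The two players are `0` and `1`
(as elements of `Fin 2`, embedded into `Fin 3` via `Fin.castSucc`), and an internal
node `u` with `owner u = 2` is a chance node.  `sim i` is the information-partition
equivalence relation of player `i` on the internal nodes owned by player `i`. -/
structure EFG where
  H : Finset (List ℕ)
  root_mem : ([] : List ℕ) ∈ H
  prefix_closed : ∀ u v : List ℕ, u <+: v → v ∈ H → u ∈ H
  owner : List ℕ → Fin 3
  sim : Fin 2 → List ℕ → List ℕ → Prop
  sim_mem : ∀ i u v, sim i u v → (∃ a, u ++ [a] ∈ H) ∧ owner u = Fin.castSucc i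
  sim_refl : ∀ i u, (∃ a, u ++ [a] ∈ H) → owner u = Fin.castSucc i → sim i u u
  sim_symm : ∀ i u v, sim i u v → sim i v u
  sim_trans : ∀ i u v w, sim i u v → sim i v w → sim i u w
  sim_actions : ∀ i u v, sim i u v → ∀ a : ℕ, u ++ [a] ∈ H ↔ v ++ [a] ∈ H

namespace EFG

variable (G : EFG)

/-- A node is internal if it has at least one child in the tree. -/
def Internal (u : List ℕ) : Prop := ∃ a, u ++ [a] ∈ G.H

/-- The (finite) set of actions `A(u) = {a : u ++ [a] ∈ H}` available at node `u`. -/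
noncomputable def actions (u : List ℕ) : Finset ℕ :=
  (G.H.finite_toSet.preimage (f := fun a : ℕ => u ++ [a])
    (fun a _ b _ hab => by simpa using hab)).toFinset

/-- `I` is an information set of player `i`: an equivalence class of `sim i`. -/
def InfoSet (i : Fin 2) (I : Set (List ℕ)) : Prop :=
  ∃ u, G.sim i u u ∧ I = {v | G.sim i u v}

/-- `seqᵢ(u)`: the list (ordered by increasing length of the prefix `w`) of pairs
`(I, a)` such that `w ++ [a] ≼ u` for some internal node `w` owned by player `i`
whose information set is `I`. -/
noncomputable def playerSeq (i : Fin 2) (u : List ℕ) : List (Set (List ℕ) × ℕ) :=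
  (List.range u.length).filterMap fun k =>
    if G.Internal (u.take k) ∧ G.owner (u.take k) = Fin.castSucc i then
      some ({v | G.sim i (u.take k) v}, u.getD k 0)
    else none

/-- Perfect recall: nodes in the same information set have the same player sequence. -/
def PerfectRecall : Prop := ∀ i u v, G.sim i u v → G.playerSeq i u = G.playerSeq i v

/-- The parent sequence `σ(I)` of an information set `I` of player `i`: the last
element of `seqᵢ(u)` for `u ∈ I` (`none` encodes the empty sequence `∅`). -/
noncomputable def parentSeq (i : Fin 2) (I : Set (List ℕ)) : SeqP :=
  if h : ∃ u, u ∈ I then (G.playerSeq i h.choose).getLast? else none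

/-- All chance moves are public: any two nodes in the same information set have
the same set of chance moves (pairs of a chance node and an action) on their paths. -/
def PublicChance : Prop :=
  ∀ i u v, G.sim i u v →
    {p : List ℕ × ℕ | G.Internal p.1 ∧ G.owner p.1 = 2 ∧ p.1 ++ [p.2] <+: u} =
    {p : List ℕ × ℕ | G.Internal p.1 ∧ G.owner p.1 = 2 ∧ p.1 ++ [p.2] <+: v}

/-- Triangle-freeness of the game. -/
def TriangleFree : Prop :=
  ¬ ∃ I₁ I₂ J₁ J₂ : Set (List ℕ),
      G.InfoSet 0 I₁ ∧ G.InfoSet 0 I₂ ∧ G.InfoSet 1 J₁ ∧ G.InfoSet 1 J₂ ∧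
      I₁ ≠ I₂ ∧ J₁ ≠ J₂ ∧
      G.parentSeq 0 I₁ = G.parentSeq 0 I₂ ∧ G.parentSeq 1 J₁ = G.parentSeq 1 J₂ ∧
      Connected I₁ J₁ ∧ Connected I₂ J₂ ∧ Connected I₁ J₂

/-- `σ` is a member of `Σᵢ`, the set of sequences of player `i`. -/
def IsSeq (i : Fin 2) (σ : SeqP) : Prop :=
  σ = none ∨ ∃ I a, σ = some (I, a) ∧ G.InfoSet i I ∧ ∃ u ∈ I, u ++ [a] ∈ G.H

/-- `(σ₁, σ₂)` is a relevant sequence pair, `σ₁ ⇌ σ₂`. -/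
def RelPair (σ₁ σ₂ : SeqP) : Prop :=
  G.IsSeq 0 σ₁ ∧ G.IsSeq 1 σ₂ ∧
    (σ₁ = none ∨ σ₂ = none ∨
      ∃ I₁ a₁ I₂ a₂, σ₁ = some (I₁, a₁) ∧ σ₂ = some (I₂, a₂) ∧ Connected I₁ I₂)

/-- `σ₂ ∈ Σ₂` is relevant for the player-1 information set `I₁`. -/
def RelFor₁ (σ₂ : SeqP) (I₁ : Set (List ℕ)) : Prop :=
  σ₂ = none ∨ ∃ I₂ a₂, σ₂ = some (I₂, a₂) ∧ Connected I₁ I₂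

/-- `σ₁ ∈ Σ₁` is relevant for the player-2 information set `I₂`. -/
def RelFor₂ (σ₁ : SeqP) (I₂ : Set (List ℕ)) : Prop :=
  σ₁ = none ∨ ∃ I₁ a₁, σ₁ = some (I₁, a₁) ∧ Connected I₁ I₂

/-- The index set of correlation plans: the relevant sequence pairs `Σ₁ ⇌ Σ₂`. -/
abbrev Idx := {p : SeqP × SeqP // G.RelPair p.1 p.2}

/-- The entry of a vector `v` indexed by relevant pairs at the pair `(σ₁, σ₂)`
(and `0` at irrelevant pairs, which never occur in the constraints below). -/
noncomputable def val (v : G.Idx → ℝ) (σ₁ σ₂ : SeqP) : ℝ :=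
  if h : G.RelPair σ₁ σ₂ then v ⟨(σ₁, σ₂), h⟩ else 0

/-- The von Stengel–Forges polytope `𝒱`. -/
def VSF : Set (G.Idx → ℝ) :=
  {v | (∀ p, 0 ≤ v p) ∧
    G.val v none none = 1 ∧
    (∀ I₁, G.InfoSet 0 I₁ → ∀ σ₂, G.IsSeq 1 σ₂ → RelFor₁ σ₂ I₁ → ∀ u ∈ I₁,
      ∑ a ∈ G.actions u, G.val v (some (I₁, a)) σ₂ = G.val v (G.parentSeq 0 I₁) σ₂) ∧
    (∀ I₂, G.InfoSet 1 I₂ → ∀ σ₁, G.IsSeq 0 σ₁ → RelFor₂ σ₁ I₂ → ∀ u ∈ I₂,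
      ∑ a ∈ G.actions u, G.val v σ₁ (some (I₂, a)) = G.val v σ₁ (G.parentSeq 1 I₂))}

/-- `π` is a reduced-normal-form plan for player `i`. -/
def IsPlan (i : Fin 2) (π : PlanT) : Prop :=
  (∀ I, ¬ G.InfoSet i I → π I = none) ∧
  (∀ I, G.InfoSet i I →
    ((π I).isSome = true ↔ ∀ u ∈ I, ∀ p ∈ G.playerSeq i u, π p.1 = some p.2)) ∧
  (∀ I a, G.InfoSet i I → π I = some a → ∃ u ∈ I, u ++ [a] ∈ G.H)

/-- `Πᵢ(σ)`: the set of reduced-normal-form plans of player `i` compatible with `σ`. -/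
def PlanSet (i : Fin 2) : SeqP → Set PlanT
  | none => {π | G.IsPlan i π}
  | some (I, a) => {π | G.IsPlan i π ∧ π I = some a}

/-- `μ` is a probability distribution on `Π₁ × Π₂`. -/
def IsDist (μ : PlanT × PlanT → ℝ) : Prop :=
  (∀ q, 0 ≤ μ q) ∧ (Function.support μ).Finite ∧
  (∀ q, μ q ≠ 0 → G.IsPlan 0 q.1 ∧ G.IsPlan 1 q.2) ∧
  ∑ᶠ q, μ q = 1

/-- The linear map `f` from distributions on `Π₁ × Π₂` to correlation plans. -/
noncomputable def corrMap (μ : PlanT × PlanT → ℝ) : G.Idx → ℝ :=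
  fun p => ∑ᶠ q ∈ {q : PlanT × PlanT | q.1 ∈ G.PlanSet 0 p.1.1 ∧ q.2 ∈ G.PlanSet 1 p.1.2}, μ q

/-- The polytope of correlation plans `Ξ`: the image of the probability distributions
on `Π₁ × Π₂` under `f`. -/
def corrPoly : Set (G.Idx → ℝ) := {x | ∃ μ, G.IsDist μ ∧ x = G.corrMap μ}

/-- The `σ₁`-rank of a player-2 information set `I₂`: the number of player-1
information sets connected to `I₂` whose parent sequence is `σ₁`. -/
noncomputable def rank₁ (σ₁ : SeqP) (I₂ : Set (List ℕ)) : ℕ :=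
  Nat.card {J : Set (List ℕ) // G.InfoSet 0 J ∧ Connected J I₂ ∧ G.parentSeq 0 J = σ₁}

/-- The `σ₂`-rank of a player-1 information set `I₁`: the number of player-2
information sets connected to `I₁` whose parent sequence is `σ₂`. -/
noncomputable def rank₂ (σ₂ : SeqP) (I₁ : Set (List ℕ)) : ℕ :=
  Nat.card {J : Set (List ℕ) // G.InfoSet 1 J ∧ Connected I₁ J ∧ G.parentSeq 1 J = σ₂}

end EFG

/-- The point-mass distribution `𝟙_{q₀}` on pairs of plans. -/
noncomputable def pointMass (q₀ : PlanT × PlanT) : PlanT × PlanT → ℝ :=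
  fun q => if q = q₀ then 1 else 0

/-- The scaled-extension step used in the decomposition: given `X ⊆ ℝⁿ`, `Y ⊆ ℝᵐ` and
`h : ℝⁿ → ℝ`, this is the scaled extension `X ⋉ʰ Y = {(x, h(x) • y)}`, realized inside
`ℝ^(n+m)` by appending coordinates. -/
def appendScaledExt {n m : ℕ} (X : Set (Fin n → ℝ)) (Y : Set (Fin m → ℝ))
    (h : (Fin n → ℝ) → ℝ) : Set (Fin (n + m) → ℝ) :=
  {z | ∃ x ∈ X, ∃ y ∈ Y, z = Fin.append x (h x • y)}

/-- `cumdim dims k = 1 + dims 0 + ⋯ + dims (k-1)`: the dimension of the ambient space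
after `k` scaled-extension steps. -/
def cumdim (dims : ℕ → ℕ) : ℕ → ℕ
  | 0 => 1
  | k + 1 => cumdim dims k + dims k

/-- The chain of polytopes `𝒫₀ = {1}`, `𝒫ₖ₊₁ = 𝒫ₖ ⋉^{hₖ} 𝒳ₖ` of the
scaled-extension-based decomposition. -/
def seChain (dims : ℕ → ℕ) (X : (k : ℕ) → Set (Fin (dims k) → ℝ))
    (h : (k : ℕ) → (Fin (cumdim dims k) → ℝ) → ℝ) :
    (k : ℕ) → Set (Fin (cumdim dims k) → ℝ)
  | 0 => {fun _ => 1}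
  | k + 1 => appendScaledExt (seChain dims X h k) (X k) (h k)

/-- Enumeration of the coordinates of a chain which starts with the coordinate `r` and then
appends the blocks of coordinates `B 0`, `B 1`, …. -/
noncomputable def chainCoord {ι : Type*} (r : ι) (B : ℕ → Finset ι) :
    (k : ℕ) → Fin (cumdim (fun k => (B k).card) k) → ι
  | 0 => fun _ => r
  | k + 1 => Fin.append (chainCoord r B k) (fun j => ((B k).equivFin.symm j : ι))

/-- The linear function summing the coordinates which are enumerated in `S k`. -/
noncomputable def chainFun {ι : Type*} (r : ι) (B S : ℕ → Finset ι) (k : ℕ)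
    (w : Fin (cumdim (fun k => (B k).card) k) → ℝ) : ℝ :=
  ∑ i, if chainCoord r B k i ∈ S k then w i else 0

theorem isLinearMap_chainFun {ι : Type*} (r : ι) (B S : ℕ → Finset ι) (k : ℕ) :
    IsLinearMap ℝ (chainFun r B S k) where
  map_add x y := by
    simp only [chainFun, ← Finset.sum_add_distrib]
    refine Finset.sum_congr rfl fun i _ => ?_
    split_ifs <;> simp
  map_smul c x := by
    simp only [chainFun, smul_eq_mul, Finset.mul_sum]
    refine Finset.sum_congr rfl fun i _ => ?_
    split_ifs <;> simp

theorem chainFun_comp {ι : Type*} {r : ι} {B S : ℕ → Finset ι} {k : ℕ}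
    (hinj : Function.Injective (chainCoord r B k))
    (hS : ∀ p ∈ S k, p ∈ Set.range (chainCoord r B k)) (v : ι → ℝ) :
    chainFun r B S k (v ∘ chainCoord r B k) = ∑ p ∈ S k, v p := by
  have himg : S k = (Finset.univ.filter fun i => chainCoord r B k i ∈ S k).image
      (chainCoord r B k) := by
    ext p
    simp only [Finset.mem_image, Finset.mem_filter, Finset.mem_univ, true_and]
    constructor
    · intro hp
      obtain ⟨i, rfl⟩ := hS p hp
      exact ⟨i, hp, rfl⟩
    · rintro ⟨i, hi, rfl⟩
      exact hi
  rw [himg, Finset.sum_image fun i _ j _ hij => hinj hij, Finset.sum_filter]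
  simp [chainFun]

theorem range_chainCoord {ι : Type*} (r : ι) (B : ℕ → Finset ι) (k : ℕ) :
    Set.range (chainCoord r B k) = {p | p = r ∨ ∃ j < k, p ∈ B j} := by
  induction k with
  | zero =>
    ext p
    simp only [chainCoord, Set.mem_range, Set.mem_ofPred_eq, not_lt_zero, false_and, exists_false,
      or_false]
    exact ⟨fun ⟨_, h⟩ => h.symm, fun h => ⟨(0 : Fin 1), h.symm⟩⟩
  | succ k ih =>
    ext p
    have h1 : p ∈ Set.range (chainCoord r B (k + 1)) ↔
        p ∈ Set.range (chainCoord r B k) ∨ p ∈ B k := by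
      constructor
      · rintro ⟨i, rfl⟩
        refine Fin.addCases (fun i => ?_) (fun j => ?_) i
        · left
          exact ⟨i, (Fin.append_left _ _ i).symm⟩
        · right
          simp only [chainCoord]
          rw [Fin.append_right]
          exact ((B k).equivFin.symm j).2
      · rintro (⟨i, rfl⟩ | hp)
        · exact ⟨Fin.castAdd _ i, Fin.append_left _ _ i⟩
        · refine ⟨Fin.natAdd _ ((B k).equivFin ⟨p, hp⟩), ?_⟩
          simp only [chainCoord]
          rw [Fin.append_right]
          simp
    rw [h1, ih]
    simp only [Set.mem_ofPred_eq, Nat.lt_succ_iff_lt_or_eq, or_and_right, exists_or,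
      exists_eq_left, or_assoc]

theorem injective_chainCoord {ι : Type*} {r : ι} {B : ℕ → Finset ι} {k : ℕ}
    (hB : ∀ i < k, ∀ p ∈ B i, p ≠ r ∧ ∀ j < i, p ∉ B j) :
    Function.Injective (chainCoord r B k) := by
  induction k with
  | zero =>
    intro i j _
    exact Subsingleton.elim (α := Fin 1) i j
  | succ k ih =>
    have hk := ih fun i hi => hB i (hi.trans k.lt_succ_self)
    simp only [chainCoord]
    refine Fin.append_injective_iff.2 ⟨hk, fun i j hij => ?_, fun i j hij => ?_⟩
    · exact (B k).equivFin.symm.injective (Subtype.ext hij)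
    · have h1 : chainCoord r B k i ∈ Set.range (chainCoord r B k) := ⟨i, rfl⟩
      rw [range_chainCoord, hij] at h1
      obtain ⟨h2, h3⟩ := hB k k.lt_succ_self _ ((B k).equivFin.symm j).2
      rcases h1 with h | ⟨l, hl, h⟩
      · exact h2 h
      · exact h3 l hl h

theorem mem_seChain_iff {ι : Type*} {r : ι} {B S : ℕ → Finset ι} {k : ℕ}
    (hne : ∀ i < k, (B i).Nonempty)
    (hB : ∀ i < k, ∀ p ∈ B i, p ≠ r ∧ ∀ j < i, p ∉ B j)
    (hS : ∀ i < k, ∀ p ∈ S i, p = r ∨ ∃ j < i, p ∈ B j)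
    (w : Fin (cumdim (fun k => (B k).card) k) → ℝ) :
    w ∈ seChain (fun k => (B k).card) (fun k => stdSimplex ℝ (Fin (B k).card))
        (chainFun r B S) k ↔
      ∃ v : ι → ℝ, (∀ p, 0 ≤ v p) ∧ v r = 1 ∧ (∀ i < k, ∑ p ∈ B i, v p = ∑ p ∈ S i, v p) ∧
        w = v ∘ chainCoord r B k := by
  induction k with
  | zero =>
    simp only [seChain, chainCoord, Set.mem_singleton_iff, not_lt_zero, false_imp_iff,
      implies_true, true_and]
    constructor
    · rintro rfl
      exact ⟨fun _ => 1, fun _ => zero_le_one, rfl, rfl⟩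
    · rintro ⟨v, -, hv, rfl⟩
      funext i
      exact hv
  | succ k ih =>
    have hlt : ∀ {i}, i < k → i < k + 1 := fun hi => hi.trans k.lt_succ_self
    have hinj : Function.Injective (chainCoord r B k) :=
      injective_chainCoord fun i hi => hB i (hlt hi)
    have hSk : ∀ p ∈ S k, p ∈ Set.range (chainCoord r B k) := by
      intro p hp
      rw [range_chainCoord]
      exact hS k k.lt_succ_self p hp
    have hdisj : ∀ p ∈ B k, p ∉ Set.range (chainCoord r B k) := by
      intro p hp
      rw [range_chainCoord]
      obtain ⟨h2, h3⟩ := hB k k.lt_succ_self p hp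
      rintro (h | ⟨l, hl, h⟩)
      · exact h2 h
      · exact h3 l hl h
    have ih' := fun x => ih (fun i hi => hne i (hlt hi)) (fun i hi => hB i (hlt hi))
      (fun i hi => hS i (hlt hi)) x
    have hsum : ∀ f : ι → ℝ, ∑ p ∈ B k, f p =
        ∑ j : Fin (B k).card, f ((B k).equivFin.symm j) := by
      intro f
      rw [← Finset.sum_coe_sort, ← (B k).equivFin.symm.sum_comp]
    constructor
    · rintro ⟨x, hx, y, hy, rfl⟩
      obtain ⟨v, hv0, hvr, hveq, rfl⟩ := (ih' x).1 hx
      set H := chainFun r B S k (v ∘ chainCoord r B k) with hH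
      have hHS : H = ∑ p ∈ S k, v p := chainFun_comp hinj hSk v
      have hH0 : 0 ≤ H := hHS ▸ Finset.sum_nonneg fun p _ => hv0 p
      let v' : ι → ℝ := fun p => if hp : p ∈ B k then H * y ((B k).equivFin ⟨p, hp⟩) else v p
      have hv'old : ∀ p, p = r ∨ (∃ j < k, p ∈ B j) → v' p = v p := by
        intro p hp
        have : p ∉ B k := fun h => hdisj p h (by rw [range_chainCoord]; exact hp)
        simp [v', this]
      have hv'new : ∀ j, v' ((B k).equivFin.symm j) = H * y j := by
        intro j
        simp [v']
      refine ⟨v', fun p => ?_, ?_, fun i hi => ?_, ?_⟩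
      · simp only [v']
        split_ifs
        · exact mul_nonneg hH0 (hy.1 _)
        · exact hv0 p
      · rw [hv'old r (Or.inl rfl), hvr]
      · rcases Nat.lt_succ_iff_lt_or_eq.1 hi with hi' | rfl
        · rw [Finset.sum_congr rfl fun p hp => hv'old p (Or.inr ⟨i, hi', hp⟩), hveq i hi']
          refine Finset.sum_congr rfl fun p hp => (hv'old p ?_).symm
          rcases hS i hi p hp with h | ⟨j, hj, h⟩
          · exact Or.inl h
          · exact Or.inr ⟨j, hj.trans hi', h⟩
        · rw [hsum, Finset.sum_congr rfl fun j _ => hv'new j, ← Finset.mul_sum, hy.2, mul_one, hHS]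
          exact Finset.sum_congr rfl fun p hp => (hv'old p (hS i hi p hp)).symm
      · funext i
        refine Fin.addCases (fun i => ?_) (fun j => ?_) i
        · simp only [chainCoord, Function.comp]
          rw [Fin.append_left, Fin.append_left]
          have : chainCoord r B k i ∈ Set.range (chainCoord r B k) := ⟨i, rfl⟩
          rw [range_chainCoord] at this
          exact (hv'old _ this).symm
        · simp only [chainCoord, Function.comp]
          rw [Fin.append_right, Fin.append_right, hv'new]
          rfl
    · rintro ⟨v, hv0, hvr, hveq, rfl⟩
      set H := ∑ p ∈ S k, v p with hHS
      have hH : chainFun r B S k (v ∘ chainCoord r B k) = H := chainFun_comp hinj hSk v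
      have hH0 : 0 ≤ H := Finset.sum_nonneg fun p _ => hv0 p
      have hBH : ∑ p ∈ B k, v p = H := hveq k k.lt_succ_self
      have hxmem := (ih' (v ∘ chainCoord r B k)).2
        ⟨v, hv0, hvr, fun i hi => hveq i (hlt hi), rfl⟩
      obtain ⟨y, hy, hyv⟩ : ∃ y ∈ stdSimplex ℝ (Fin (B k).card),
          ∀ j, v ((B k).equivFin.symm j) = H * y j := by
        rcases hH0.eq_or_lt with h0 | hpos
        · have j₀ : Fin (B k).card := ⟨0, Finset.card_pos.2 (hne k k.lt_succ_self)⟩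
          refine ⟨Pi.single j₀ 1, single_mem_stdSimplex ℝ j₀, fun j => ?_⟩
          rw [← h0, zero_mul]
          rw [← h0] at hBH
          exact (Finset.sum_eq_zero_iff_of_nonneg fun p _ => hv0 p).1 hBH _
            ((B k).equivFin.symm j).2
        · refine ⟨fun j => v ((B k).equivFin.symm j) / H,
            ⟨fun j => div_nonneg (hv0 _) hH0, ?_⟩, fun j => ?_⟩
          · rw [← Finset.sum_div, ← hsum, hBH, div_self hpos.ne']
          · field_simp
      refine ⟨v ∘ chainCoord r B k, hxmem, y, hy, ?_⟩
      funext i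
      refine Fin.addCases (fun i => ?_) (fun j => ?_) i
      · simp only [chainCoord, Function.comp]
        rw [Fin.append_left, Fin.append_left]
        rfl
      · simp only [chainCoord, Function.comp]
        rw [Fin.append_right, Fin.append_right, hyv]
        change _ = chainFun r B S k (v ∘ chainCoord r B k) * y j
        rw [hH]

/-- Cells of a partition of `R \ {r}` can be enumerated compatibly with a well-founded dependency
of each cell on its set of sources. -/
theorem exists_cell_enumeration {ι : Type*} (R : Finset ι) (r : ι) (cells src : ι → Finset ι)
    (hself : ∀ p ∈ R, p ≠ r → p ∈ cells p)
    (hcell : ∀ p ∈ R, p ≠ r → ∀ q ∈ cells p, q ∈ R ∧ q ≠ r ∧ cells q = cells p)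
    (hsrc : ∀ p ∈ R, p ≠ r → src p ⊆ R)
    (hwf : WellFounded fun q p => p ∈ R ∧ p ≠ r ∧ q ∈ src p) :
    ∃ (n : ℕ) (f : ℕ → ι),
      (∀ k < n, f k ∈ R ∧ f k ≠ r) ∧
      (∀ i < n, ∀ p ∈ cells (f i), p ≠ r ∧ ∀ j < i, p ∉ cells (f j)) ∧
      (∀ i < n, ∀ p ∈ src (f i), p = r ∨ ∃ j < i, p ∈ cells (f j)) ∧
      ∀ p ∈ R, p ≠ r → ∃ j < n, p ∈ cells (f j) := by
  let Good : ℕ → (ℕ → ι) → Prop := fun n f => ∀ k < n, (f k ∈ R ∧ f k ≠ r) ∧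
    (∀ j < k, f k ∉ cells (f j)) ∧ ∀ p ∈ src (f k), p = r ∨ ∃ j < k, p ∈ cells (f j)
  have hcard : ∀ n f, Good n f → n ≤ R.card := by
    intro n f hf
    rw [← Finset.card_range n]
    refine Finset.card_le_card_of_injOn f
      (fun k hk => (hf k (Finset.mem_range.1 hk)).1.1) fun i hi j hj hij => ?_
    rw [Finset.coe_range, Set.mem_Iio] at hi hj
    by_contra hne
    rcases lt_or_gt_of_ne hne with h | h
    · exact (hf j hj).2.1 i h (by rw [← hij]; exact hself _ (hf i hi).1.1 (hf i hi).1.2)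
    · exact (hf i hi).2.1 j h (by rw [hij]; exact hself _ (hf j hj).1.1 (hf j hj).1.2)
  obtain ⟨n, f, hf, hmax⟩ : ∃ n f, Good n f ∧ ¬ ∃ f', Good (n + 1) f' := by
    by_contra! hcon
    have hall : ∀ n, ∃ f, Good n f := by
      intro n
      induction n with
      | zero => exact ⟨fun _ => r, fun k hk => absurd hk (Nat.not_lt_zero k)⟩
      | succ n ih =>
        obtain ⟨f, hf⟩ := ih
        exact hcon n f hf
    obtain ⟨f, hf⟩ := hall (R.card + 1)
    exact absurd (hcard _ f hf) (by omega)
  refine ⟨n, f, fun k hk => (hf k hk).1, fun i hi p hp => ?_, fun i hi => (hf i hi).2.2, ?_⟩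
  · obtain ⟨-, h2, h3⟩ := hcell _ (hf i hi).1.1 (hf i hi).1.2 p hp
    refine ⟨h2, fun j hj hpj => (hf i hi).2.1 j hj ?_⟩
    have h4 := (hcell _ (hf j (hj.trans hi)).1.1 (hf j (hj.trans hi)).1.2 p hpj).2.2
    rw [← h4, h3]
    exact hself _ (hf i hi).1.1 (hf i hi).1.2
  · by_contra! hcon
    let M : Set ι := {p | p ∈ R ∧ p ≠ r ∧ ∀ j < n, p ∉ cells (f j)}
    have hM : M.Nonempty := hcon
    obtain ⟨p, ⟨hpR, hpr, hp⟩, hmin⟩ := hwf.has_min M hM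
    refine hmax ⟨Function.update f n p, fun k hk => ?_⟩
    have hlt : ∀ {j}, j < n → Function.update f n p j = f j := fun hj =>
      Function.update_of_ne hj.ne _ _
    rcases Nat.lt_succ_iff_lt_or_eq.1 hk with hk | rfl
    · obtain ⟨h1, h2, h3⟩ := hf k hk
      rw [hlt hk]
      refine ⟨h1, fun j hj => ?_, fun q hq => (h3 q hq).imp_right ?_⟩
      · rw [hlt (hj.trans hk)]
        exact h2 j hj
      · rintro ⟨j, hj, h⟩
        exact ⟨j, hj, by rwa [hlt (hj.trans hk)]⟩
    · rw [Function.update_self]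
      refine ⟨⟨hpR, hpr⟩, fun j hj => ?_, fun q hq => ?_⟩
      · rw [hlt hj]
        exact hp j hj
      · by_contra! hq'
        refine hmin q ⟨hsrc p hpR hpr hq, hq'.1, fun j hj => ?_⟩ ⟨hpR, hpr, hq⟩
        have := hq'.2 j hj
        rwa [hlt hj] at this

/-- Two forests of decision points (of type `α`) with action sets `A₁`, `A₂` and parent
sequences `p₁`, `p₂`, together with a connection relation `C` and an orientation of it: `F I J`
means that the decision at `J` is taken before the decision at `I`. -/
structure BiForest (α : Type*) where
  /-- Actions in the first forest. -/
  A₁ : α → Finset ℕ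
  /-- Actions in the second forest. -/
  A₂ : α → Finset ℕ
  /-- Parent sequences in the first forest. -/
  p₁ : α → Option (α × ℕ)
  /-- Parent sequences in the second forest. -/
  p₂ : α → Option (α × ℕ)
  /-- Connection between the two forests. -/
  C : α → α → Prop
  /-- Orientation of the connections. -/
  F : α → α → Prop
  /-- Depth in the first forest. -/
  d₁ : α → ℕ
  /-- Depth in the second forest. -/
  d₂ : α → ℕ
  /-- A bound for the depths. -/
  N : ℕ
  conn₁ : ∀ {I J}, C I J → (A₁ I).Nonempty
  conn₂ : ∀ {I J}, C I J → (A₂ J).Nonempty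
  parent₁ : ∀ {I I' a}, (A₁ I).Nonempty → p₁ I = some (I', a) → a ∈ A₁ I'
  parent₂ : ∀ {J J' b}, (A₂ J).Nonempty → p₂ J = some (J', b) → b ∈ A₂ J'
  depth₁ : ∀ {I I' a}, (A₁ I).Nonempty → p₁ I = some (I', a) → d₁ I' < d₁ I
  depth₂ : ∀ {J J' b}, (A₂ J).Nonempty → p₂ J = some (J', b) → d₂ J' < d₂ J
  bound₁ : ∀ {I}, (A₁ I).Nonempty → d₁ I ≤ N
  bound₂ : ∀ {J}, (A₂ J).Nonempty → d₂ J ≤ N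
  up₁ : ∀ {I I' a J}, C I J → p₁ I = some (I', a) → C I' J
  up₂ : ∀ {I J J' b}, C I J → p₂ J = some (J', b) → C I J'
  mono₁ : ∀ {I I' a J}, C I J → ¬ F I J → p₁ I = some (I', a) → ¬ F I' J
  mono₂ : ∀ {I J J' b}, C I J → F I J → p₂ J = some (J', b) → F I J'
  uniq₁ : ∀ {I I' J}, C I J → C I' J → ¬ F I J → p₁ I = p₁ I' → I = I'
  uniq₂ : ∀ {I J J'}, C I J → C I J' → F I J → p₂ J = p₂ J' → J = J'

namespace BiForest

variable {α : Type*} (s : BiForest α)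

/-- Exchange the roles of the two forests. -/
def swap : BiForest α where
  A₁ := s.A₂
  A₂ := s.A₁
  p₁ := s.p₂
  p₂ := s.p₁
  C J I := s.C I J
  F J I := ¬ s.F I J
  d₁ := s.d₂
  d₂ := s.d₁
  N := s.N
  conn₁ := s.conn₂
  conn₂ := s.conn₁
  parent₁ := s.parent₂
  parent₂ := s.parent₁
  depth₁ := s.depth₂
  depth₂ := s.depth₁
  bound₁ := s.bound₂
  bound₂ := s.bound₁
  up₁ := s.up₂
  up₂ := s.up₁
  mono₁ h hF hp := not_not.2 (s.mono₂ h (not_not.1 hF) hp)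
  mono₂ := s.mono₁
  uniq₁ h h' hF := s.uniq₂ h h' (not_not.1 hF)
  uniq₂ := s.uniq₁

theorem swap_swap : s.swap.swap = s := by
  cases s
  simp [swap]

/-- The sequence of the second forest is compatible with `I`, and the decision at `I` comes after
the sequence. -/
def Late (I : α) : Option (α × ℕ) → Prop
  | none => (s.A₁ I).Nonempty
  | some (J, b) => s.C I J ∧ s.F I J ∧ b ∈ s.A₂ J

variable {s} in
theorem Late.nonempty {I : α} {σ : Option (α × ℕ)} (h : s.Late I σ) : (s.A₁ I).Nonempty := by
  rcases σ with _ | ⟨J, b⟩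
  · exact h
  · exact s.conn₁ h.1

theorem late_parent {I J : α} (hC : s.C I J) (hF : s.F I J) : s.Late I (s.p₂ J) := by
  rcases hp : s.p₂ J with _ | ⟨J', b⟩
  · exact s.conn₁ hC
  · exact ⟨s.up₂ hC hp, s.mono₂ hC hF hp, s.parent₂ (s.conn₂ hC) hp⟩

/-- The dependencies of entries in which the first sequence comes last. -/
inductive HalfDep :
    Option (α × ℕ) × Option (α × ℕ) → Option (α × ℕ) × Option (α × ℕ) → Prop
  | sum {I a σ J b} (hK : s.Late I σ) (hC : s.C I J) (hF : s.F I J) (hp : s.p₂ J = σ)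
      (hb : b ∈ s.A₂ J) : HalfDep (some (I, a), some (J, b)) (some (I, a), σ)
  | up {I a σ} (hK : s.Late I σ) : HalfDep (s.p₁ I, σ) (some (I, a), σ)

variable {s} in
theorem HalfDep.exists_late {q p : Option (α × ℕ) × Option (α × ℕ)} (h : s.HalfDep q p) :
    ∃ I a σ, s.Late I σ ∧ p = (some (I, a), σ) := by
  rcases h with ⟨hK, _, _, _, _⟩ | hK
  · exact ⟨_, _, _, hK, rfl⟩
  · exact ⟨_, _, _, hK, rfl⟩

/-- The dependencies of entries. -/
def Dep (q p : Option (α × ℕ) × Option (α × ℕ)) : Prop :=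
  s.HalfDep q p ∨ s.swap.HalfDep q.swap p.swap

theorem acc_swap {p : Option (α × ℕ) × Option (α × ℕ)} (h : Acc s.swap.Dep p.swap) :
    Acc s.Dep p := by
  refine Subrelation.accessible (fun {q p} hqp => ?_) (InvImage.accessible Prod.swap h)
  rcases hqp with hqp | hqp
  · right
    rwa [swap_swap, Prod.swap_swap, Prod.swap_swap]
  · exact Or.inl hqp

/-- The depth of a sequence. -/
def seqDepth (d : α → ℕ) : Option (α × ℕ) → ℕ
  | none => 0
  | some (I, _) => d I + 1

theorem seqDepth_parent₁_le {I : α} (h : (s.A₁ I).Nonempty) : seqDepth s.d₁ (s.p₁ I) ≤ s.d₁ I := by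
  rcases hp : s.p₁ I with _ | ⟨I', a⟩
  · exact Nat.zero_le _
  · exact s.depth₁ h hp

theorem seqDepth_parent₂_le {J : α} (h : (s.A₂ J).Nonempty) : seqDepth s.d₂ (s.p₂ J) ≤ s.d₂ J :=
  s.swap.seqDepth_parent₁_le h

variable {s} in
theorem Late.seqDepth_le {I : α} {σ : Option (α × ℕ)} (h : s.Late I σ) :
    seqDepth s.d₂ σ ≤ s.N + 1 := by
  rcases σ with _ | ⟨J, b⟩
  · exact Nat.zero_le _
  · exact Nat.succ_le_succ (s.bound₂ (s.conn₂ h.1))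

/-- Induction along the second forest, towards the leaves. -/
theorem late_induction {I : α} {P : Option (α × ℕ) → Prop}
    (step : ∀ σ, s.Late I σ →
      (∀ J b, s.C I J → s.F I J → b ∈ s.A₂ J → s.p₂ J = σ → P (some (J, b))) → P σ)
    {σ : Option (α × ℕ)} (hσ : s.Late I σ) : P σ := by
  suffices h : ∀ k σ, s.Late I σ → s.N + 1 < seqDepth s.d₂ σ + k → P σ from
    h (s.N + 2) σ hσ (by omega)
  intro k
  induction k with
  | zero =>
    intro σ hσ hk
    have := hσ.seqDepth_le
    omega
  | succ k ih =>
    intro σ hσ hk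
    refine step σ hσ fun J b hC hF hb hp => ih _ ⟨hC, hF, hb⟩ ?_
    have h := s.seqDepth_parent₂_le (s.conn₂ hC)
    rw [hp] at h
    change _ < s.d₂ J + 1 + k
    omega

theorem forall_sibling {I I' J : α} (hC : s.C I J) (hF : s.F I J) (hC' : s.C I' J)
    (hp : s.p₁ I' = s.p₁ I) : s.F I' J := by
  by_contra hF'
  obtain rfl := s.uniq₁ hC' hC hF' hp
  exact hF' hF

theorem late_or_swap_late {I J : α} (hC : s.C I J) :
    (∃ I' a', s.p₁ I = some (I', a') ∧ s.C I' J ∧ s.F I' J) ∨ s.swap.Late J (s.p₁ I) := by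
  rcases hp : s.p₁ I with _ | ⟨I', a'⟩
  · exact Or.inr (s.conn₂ hC)
  · by_cases hF' : s.F I' J
    · exact Or.inl ⟨I', a', rfl, s.up₁ hC hp, hF'⟩
    · exact Or.inr ⟨s.up₁ hC hp, hF', s.parent₁ (s.conn₁ hC) hp⟩

theorem acc_of_late {I : α} {a : ℕ} {σ : Option (α × ℕ)} (hK : s.Late I σ)
    (hacc : Acc s.Dep (s.p₁ I, σ)) : Acc s.Dep (some (I, a), σ) := by
  revert hacc
  refine s.late_induction (P := fun σ => Acc s.Dep (s.p₁ I, σ) → Acc s.Dep (some (I, a), σ))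
    (fun σ hK ih hacc => ?_) hK
  refine Acc.intro _ fun q hq => ?_
  rcases hq with hq | hq
  · generalize hpe : (some (I, a), σ) = p at hq
    rcases hq with ⟨hK', hC, hF, hp, hb⟩ | hK'
    · rename_i I₁ a₁ σ₁ J b
      obtain ⟨h1, rfl⟩ := Prod.mk.inj hpe
      obtain ⟨rfl, rfl⟩ := Prod.mk.inj (Option.some.inj h1)
      refine ih J b hC hF hb hp ?_
      rcases s.late_or_swap_late hC with ⟨I', a', hI', hC', hF'⟩ | hL
      · rw [hI'] at hacc ⊢
        exact hacc.inv (Or.inl (.sum (hp ▸ s.late_parent hC' hF') hC' hF' hp hb))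
      · refine Acc.intro _ fun q hq => ?_
        rcases hq with hq | hq
        · exfalso
          obtain ⟨I₂, a₂, σ₂, hK₂, h⟩ := hq.exists_late
          obtain ⟨h1, rfl⟩ := Prod.mk.inj h
          rw [h1] at hL
          exact hL.2.1 hK₂.2.1
        · obtain ⟨q₁, q₂⟩ := q
          simp only [Prod.swap_prod_mk] at hq
          generalize hpe : ((some (J, b) : Option (α × ℕ)), s.p₁ I) = p at hq
          generalize hqe : (q₂, q₁) = q at hq
          rcases hq with ⟨hK₂, hC₂, hF₂, hp₂, hb₂⟩ | hK₂
          · exfalso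
            obtain ⟨h1, rfl⟩ := Prod.mk.inj hpe
            obtain ⟨rfl, rfl⟩ := Prod.mk.inj (Option.some.inj h1)
            exact hF₂ (s.forall_sibling hC hF hC₂ hp₂)
          · obtain ⟨h1, rfl⟩ := Prod.mk.inj hpe
            obtain ⟨rfl, rfl⟩ := Prod.mk.inj (Option.some.inj h1)
            obtain ⟨rfl, rfl⟩ := Prod.mk.inj hqe
            change Acc s.Dep (s.p₁ I, s.p₂ J)
            rwa [hp]
    · obtain ⟨h1, rfl⟩ := Prod.mk.inj hpe
      obtain ⟨rfl, rfl⟩ := Prod.mk.inj (Option.some.inj h1)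
      exact hacc
  · exfalso
    obtain ⟨J, b, σ₂, hK₂, h⟩ := hq.exists_late
    obtain ⟨rfl, rfl⟩ := Prod.mk.inj h
    exact hK₂.2.1 hK.2.1

/-- The first sequence of the pair is nonempty and its last decision is later than the second
sequence. -/
def LatePair : Option (α × ℕ) × Option (α × ℕ) → Prop
  | (some (I, a), σ) => a ∈ s.A₁ I ∧ s.Late I σ
  | (none, _) => False

/-- Relevant pairs of sequences. -/
def Rel : Option (α × ℕ) × Option (α × ℕ) → Prop
  | (none, none) => True
  | (some (I, a), none) => a ∈ s.A₁ I
  | (none, some (J, b)) => b ∈ s.A₂ J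
  | (some (I, a), some (J, b)) => s.C I J ∧ a ∈ s.A₁ I ∧ b ∈ s.A₂ J

theorem rel_swap {p : Option (α × ℕ) × Option (α × ℕ)} : s.swap.Rel p.swap ↔ s.Rel p := by
  rcases p with ⟨_ | ⟨I, a⟩, _ | ⟨J, b⟩⟩
  · exact Iff.rfl
  · exact Iff.rfl
  · exact Iff.rfl
  · exact and_congr_right fun _ => and_comm

variable {s} in
theorem LatePair.rel {p : Option (α × ℕ) × Option (α × ℕ)} (h : s.LatePair p) : s.Rel p := by
  rcases p with ⟨_ | ⟨I, a⟩, _ | ⟨J, b⟩⟩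
  · exact h.elim
  · exact h.elim
  · exact h.1
  · exact ⟨h.2.1, h.1, h.2.2.2⟩

variable {s} in
theorem LatePair.ne_root {p : Option (α × ℕ) × Option (α × ℕ)} (h : s.LatePair p) :
    p ≠ (none, none) := by
  rintro rfl
  exact h

theorem swap_latePair_iff {p : Option (α × ℕ) × Option (α × ℕ)} (hR : s.Rel p)
    (hp : p ≠ (none, none)) : s.swap.LatePair p.swap ↔ ¬ s.LatePair p := by
  rcases p with ⟨_ | ⟨I, a⟩, _ | ⟨J, b⟩⟩
  · exact absurd rfl hp
  · exact iff_of_true ⟨hR, ⟨b, hR⟩⟩ fun h => h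
  · exact iff_of_false (fun h => h) (not_not.2 ⟨hR, ⟨a, hR⟩⟩)
  · obtain ⟨hC, ha, hb⟩ := hR
    constructor
    · exact fun h h' => h.2.2.1 h'.2.2.1
    · exact fun h => ⟨hb, hC, fun hF => h ⟨ha, hC, hF, hb⟩, ha⟩

theorem acc_of_rel {p : Option (α × ℕ) × Option (α × ℕ)} (hR : s.Rel p) : Acc s.Dep p := by
  suffices h : ∀ k (s : BiForest α) (p : Option (α × ℕ) × Option (α × ℕ)), s.Rel p →
      seqDepth s.d₁ p.1 + seqDepth s.d₂ p.2 < k → Acc s.Dep p from h _ s p hR (Nat.lt_succ_self _)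
  intro k
  induction k with
  | zero => intro s p _ h; exact absurd h (Nat.not_lt_zero _)
  | succ k ih =>
    have main : ∀ (s : BiForest α) (p : Option (α × ℕ) × Option (α × ℕ)), s.LatePair p →
        seqDepth s.d₁ p.1 + seqDepth s.d₂ p.2 < k + 1 → Acc s.Dep p := by
      rintro s ⟨_ | ⟨I, a⟩, σ⟩ hL hk
      · exact hL.elim
      · refine s.acc_of_late hL.2 (ih s _ ?_ ?_)
        · rcases hp : s.p₁ I with _ | ⟨I', a'⟩ <;> rcases σ with _ | ⟨J, b⟩
          · trivial
          · exact hL.2.2.2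
          · exact s.parent₁ hL.2.nonempty hp
          · exact ⟨s.up₁ hL.2.1 hp, s.parent₁ hL.2.nonempty hp, hL.2.2.2⟩
        · have := s.seqDepth_parent₁_le hL.2.nonempty
          change s.d₁ I + 1 + seqDepth s.d₂ σ < k + 1 at hk
          change seqDepth s.d₁ (s.p₁ I) + seqDepth s.d₂ σ < k
          omega
    intro s p hR hk
    by_cases hp : p = (none, none)
    · subst hp
      refine Acc.intro _ fun q hq => ?_
      rcases hq with hq | hq <;> obtain ⟨I, a, σ, -, h⟩ := hq.exists_late <;> simp at h
    · by_cases hL : s.LatePair p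
      · exact main s p hL hk
      · refine s.acc_swap (main s.swap p.swap ((s.swap_latePair_iff hR hp).2 hL) ?_)
        rw [add_comm]
        exact hk

/-- The linear equations defining entries in which the first sequence comes last. -/
structure HalfFill (V : Option (α × ℕ) × Option (α × ℕ) → ℝ) : Prop where
  leaf : ∀ {I J a}, s.C I J → s.F I J → a ∈ s.A₁ I →
    V (some (I, a), s.p₂ J) = ∑ b ∈ s.A₂ J, V (some (I, a), some (J, b))
  center : ∀ {I σ}, s.Late I σ → (∀ J, s.C I J → s.F I J → s.p₂ J ≠ σ) →
    ∑ a ∈ s.A₁ I, V (some (I, a), σ) = V (s.p₁ I, σ)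

/-- The sequence of the second forest is relevant for `I`. -/
def RelFor (I : α) : Option (α × ℕ) → Prop
  | none => (s.A₁ I).Nonempty
  | some (J, b) => s.C I J ∧ b ∈ s.A₂ J

/-- The flow conservation equations for the first forest. -/
def Balanced (V : Option (α × ℕ) × Option (α × ℕ) → ℝ) : Prop :=
  ∀ I σ, s.RelFor I σ → ∑ a ∈ s.A₁ I, V (some (I, a), σ) = V (s.p₁ I, σ)

variable {s} in
theorem HalfFill.sum_of_late {V : Option (α × ℕ) × Option (α × ℕ) → ℝ} (h₁ : s.HalfFill V)
    (h₂ : s.swap.HalfFill (V ∘ Prod.swap)) {I : α} {σ : Option (α × ℕ)} (hK : s.Late I σ) :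
    ∑ a ∈ s.A₁ I, V (some (I, a), σ) = V (s.p₁ I, σ) := by
  refine s.late_induction (P := fun σ => ∑ a ∈ s.A₁ I, V (some (I, a), σ) = V (s.p₁ I, σ))
    (fun σ hK ih => ?_) hK
  by_cases hleaf : ∃ J, s.C I J ∧ s.F I J ∧ s.p₂ J = σ
  · obtain ⟨J, hC, hF, rfl⟩ := hleaf
    rw [Finset.sum_congr rfl fun a ha => h₁.leaf hC hF ha, Finset.sum_comm,
      Finset.sum_congr rfl fun b hb => ih J b hC hF hb rfl]
    rcases s.late_or_swap_late hC with ⟨I', a', hI', hC', hF'⟩ | hL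
    · rw [hI']
      exact (h₁.leaf hC' hF' (s.parent₁ (s.conn₁ hC) hI')).symm
    · exact h₂.center hL fun I₂ hC₂ hF₂ hp₂ => hF₂ (s.forall_sibling hC hF hC₂ hp₂)
  · exact h₁.center hK fun J hC hF hp => hleaf ⟨J, hC, hF, hp⟩

variable {s} in
theorem HalfFill.balanced {V : Option (α × ℕ) × Option (α × ℕ) → ℝ} (h₁ : s.HalfFill V)
    (h₂ : s.swap.HalfFill (V ∘ Prod.swap)) : s.Balanced V := by
  rintro I (_ | ⟨J, b⟩) hR
  · exact h₁.sum_of_late h₂ hR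
  · by_cases hF : s.F I J
    · exact h₁.sum_of_late h₂ (show s.Late I (some (J, b)) from ⟨hR.1, hF, hR.2⟩)
    · exact (h₂.leaf (show s.swap.C J I from hR.1) hF hR.2).symm

open Classical in
/-- The entries which are determined together with a given entry in which the first sequence comes
last. -/
noncomputable def halfCell :
    Option (α × ℕ) × Option (α × ℕ) → Finset (Option (α × ℕ) × Option (α × ℕ))
  | (some (I, a), σ) =>
    if ∃ J, s.C I J ∧ s.F I J ∧ s.p₂ J = σ then {(some (I, a), σ)}
    else (s.A₁ I).image fun a' => (some (I, a'), σ)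
  | (none, _) => ∅

open Classical in
/-- The entries which determine the sum over `halfCell`. -/
noncomputable def halfSrc :
    Option (α × ℕ) × Option (α × ℕ) → Finset (Option (α × ℕ) × Option (α × ℕ))
  | (some (I, a), σ) =>
    if h : ∃ J, s.C I J ∧ s.F I J ∧ s.p₂ J = σ then
      (s.A₂ h.choose).image fun b => (some (I, a), some (h.choose, b))
    else {(s.p₁ I, σ)}
  | (none, _) => ∅

variable {s} in
theorem LatePair.mem_halfCell {p : Option (α × ℕ) × Option (α × ℕ)} (h : s.LatePair p) :
    p ∈ s.halfCell p := by
  rcases p with ⟨_ | ⟨I, a⟩, σ⟩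
  · exact h.elim
  · simp only [halfCell]
    split_ifs
    · exact Finset.mem_singleton_self _
    · exact Finset.mem_image_of_mem _ h.1

variable {s} in
theorem LatePair.of_mem_halfCell {p q : Option (α × ℕ) × Option (α × ℕ)} (h : s.LatePair p)
    (hq : q ∈ s.halfCell p) :
    s.LatePair q ∧ s.halfCell q = s.halfCell p ∧ s.halfSrc q = s.halfSrc p := by
  rcases p with ⟨_ | ⟨I, a⟩, σ⟩
  · exact h.elim
  · simp only [halfCell] at hq
    split_ifs at hq with hleaf
    · rw [Finset.mem_singleton.1 hq]
      exact ⟨h, rfl, rfl⟩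
    · obtain ⟨a', ha', rfl⟩ := Finset.mem_image.1 hq
      refine ⟨⟨ha', h.2⟩, ?_, ?_⟩
      · simp only [halfCell, if_neg hleaf]
      · simp only [halfSrc, dif_neg hleaf]

variable {s} in
theorem LatePair.of_mem_halfSrc {p q : Option (α × ℕ) × Option (α × ℕ)} (h : s.LatePair p)
    (hq : q ∈ s.halfSrc p) : s.Rel q ∧ s.HalfDep q p := by
  rcases p with ⟨_ | ⟨I, a⟩, σ⟩
  · exact h.elim
  · simp only [halfSrc] at hq
    split_ifs at hq with hleaf
    · obtain ⟨b, hb, rfl⟩ := Finset.mem_image.1 hq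
      obtain ⟨hC, hF, hp⟩ := hleaf.choose_spec
      exact ⟨⟨hC, h.1, hb⟩, .sum h.2 hC hF hp hb⟩
    · rw [Finset.mem_singleton.1 hq]
      refine ⟨?_, .up h.2⟩
      rcases hp : s.p₁ I with _ | ⟨I', a'⟩ <;> rcases σ with _ | ⟨J, b⟩
      · trivial
      · exact h.2.2.2
      · exact s.parent₁ h.2.nonempty hp
      · exact ⟨s.up₁ h.2.1 hp, s.parent₁ h.2.nonempty hp, h.2.2.2⟩

theorem halfFill_of_halfCell {V : Option (α × ℕ) × Option (α × ℕ) → ℝ}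
    (h : ∀ p, s.LatePair p → ∑ q ∈ s.halfCell p, V q = ∑ q ∈ s.halfSrc p, V q) :
    s.HalfFill V where
  leaf {I J a} hC hF ha := by
    have hleaf : ∃ J', s.C I J' ∧ s.F I J' ∧ s.p₂ J' = s.p₂ J := ⟨J, hC, hF, rfl⟩
    have hJ : hleaf.choose = J := by
      obtain ⟨hC', hF', hp'⟩ := hleaf.choose_spec
      exact s.uniq₂ hC' hC hF' hp'
    have := h (some (I, a), s.p₂ J) ⟨ha, s.late_parent hC hF⟩
    simp only [halfCell, halfSrc, if_pos hleaf, dif_pos hleaf, hJ, Finset.sum_singleton] at this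
    rw [this, Finset.sum_image]
    intro b _ b' _ hbb
    simpa using hbb
  center {I σ} hK hcen := by
    have hleaf : ¬ ∃ J', s.C I J' ∧ s.F I J' ∧ s.p₂ J' = σ := fun ⟨J, h1, h2, h3⟩ =>
      hcen J h1 h2 h3
    obtain ⟨a, ha⟩ := hK.nonempty
    have := h (some (I, a), σ) ⟨ha, hK⟩
    simp only [halfCell, halfSrc, if_neg hleaf, dif_neg hleaf, Finset.sum_singleton] at this
    rw [← this, Finset.sum_image]
    intro b _ b' _ hbb
    simpa using hbb

variable {s} in
theorem LatePair.sum_halfCell {V : Option (α × ℕ) × Option (α × ℕ) → ℝ} (h₁ : s.Balanced V)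
    (h₂ : s.swap.Balanced (V ∘ Prod.swap)) {p : Option (α × ℕ) × Option (α × ℕ)}
    (h : s.LatePair p) : ∑ q ∈ s.halfCell p, V q = ∑ q ∈ s.halfSrc p, V q := by
  rcases p with ⟨_ | ⟨I, a⟩, σ⟩
  · exact h.elim
  · by_cases hleaf : ∃ J', s.C I J' ∧ s.F I J' ∧ s.p₂ J' = σ
    · obtain ⟨hC, hF, hp⟩ := hleaf.choose_spec
      have := h₂ hleaf.choose (some (I, a)) ⟨hC, h.1⟩
      simp only [halfCell, halfSrc, if_pos hleaf, dif_pos hleaf, Finset.sum_singleton]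
      rw [Finset.sum_image (by intro b _ b' _ hbb; simpa using hbb)]
      conv_lhs => rw [← hp]
      exact this.symm
    · simp only [halfCell, halfSrc, if_neg hleaf, dif_neg hleaf, Finset.sum_singleton]
      rw [Finset.sum_image (by intro b _ b' _ hbb; simpa using hbb)]
      refine h₁ I σ ?_
      rcases σ with _ | ⟨J, b⟩
      · exact h.2
      · exact ⟨h.2.1, h.2.2.2⟩

open Classical in
/-- The entries which are determined together with a given entry. -/
noncomputable def cell (p : Option (α × ℕ) × Option (α × ℕ)) :
    Finset (Option (α × ℕ) × Option (α × ℕ)) :=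
  if s.LatePair p then s.halfCell p else (s.swap.halfCell p.swap).image Prod.swap

open Classical in
/-- The entries which determine the sum over `cell`. -/
noncomputable def src (p : Option (α × ℕ) × Option (α × ℕ)) :
    Finset (Option (α × ℕ) × Option (α × ℕ)) :=
  if s.LatePair p then s.halfSrc p else (s.swap.halfSrc p.swap).image Prod.swap

theorem mem_image_swap {X : Type*} [DecidableEq (X × X)] {S : Finset (X × X)} {p : X × X} :
    p ∈ S.image Prod.swap ↔ p.swap ∈ S := by
  constructor
  · intro h
    obtain ⟨q, hq, rfl⟩ := Finset.mem_image.1 h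
    rwa [Prod.swap_swap]
  · intro h
    exact Finset.mem_image.2 ⟨_, h, Prod.swap_swap p⟩

theorem mem_cell_self {p : Option (α × ℕ) × Option (α × ℕ)} (hR : s.Rel p)
    (hp : p ≠ (none, none)) : p ∈ s.cell p := by
  unfold cell
  split_ifs with hL
  · exact hL.mem_halfCell
  · exact mem_image_swap.2 ((s.swap_latePair_iff hR hp).2 hL).mem_halfCell

theorem of_mem_cell {p q : Option (α × ℕ) × Option (α × ℕ)} (hR : s.Rel p)
    (hp : p ≠ (none, none)) (hq : q ∈ s.cell p) :
    s.Rel q ∧ q ≠ (none, none) ∧ s.cell q = s.cell p ∧ s.src q = s.src p := by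
  by_cases hL : s.LatePair p
  · simp only [cell, src, if_pos hL] at hq ⊢
    obtain ⟨h1, h2, h3⟩ := hL.of_mem_halfCell hq
    simp only [if_pos h1]
    exact ⟨h1.rel, h1.ne_root, h2, h3⟩
  · simp only [cell, src, if_neg hL] at hq ⊢
    obtain ⟨h1, h2, h3⟩ := ((s.swap_latePair_iff hR hp).2 hL).of_mem_halfCell (mem_image_swap.1 hq)
    have hRq : s.Rel q := s.rel_swap.1 h1.rel
    have hq0 : q ≠ (none, none) := fun h => h1.ne_root (by rw [h]; rfl)
    simp only [if_neg ((s.swap_latePair_iff hRq hq0).1 h1), h2, h3]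
    exact ⟨hRq, hq0, trivial, trivial⟩

theorem of_mem_src {p q : Option (α × ℕ) × Option (α × ℕ)} (hR : s.Rel p)
    (hp : p ≠ (none, none)) (hq : q ∈ s.src p) : s.Rel q ∧ s.Dep q p := by
  by_cases hL : s.LatePair p
  · simp only [src, if_pos hL] at hq
    exact (hL.of_mem_halfSrc hq).imp_right Or.inl
  · simp only [src, if_neg hL] at hq
    obtain ⟨h1, h2⟩ := ((s.swap_latePair_iff hR hp).2 hL).of_mem_halfSrc (mem_image_swap.1 hq)
    exact ⟨s.rel_swap.1 h1, Or.inr h2⟩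

theorem sum_cell_iff {V : Option (α × ℕ) × Option (α × ℕ) → ℝ} :
    (∀ p, s.Rel p → p ≠ (none, none) → ∑ q ∈ s.cell p, V q = ∑ q ∈ s.src p, V q) ↔
      s.Balanced V ∧ s.swap.Balanced (V ∘ Prod.swap) := by
  have hsum : ∀ S : Finset (Option (α × ℕ) × Option (α × ℕ)),
      ∑ q ∈ S.image Prod.swap, V q = ∑ q ∈ S, (V ∘ Prod.swap) q := fun S =>
    Finset.sum_image fun _ _ _ _ h => Prod.swap_injective h
  have hVV : (V ∘ Prod.swap) ∘ Prod.swap = V := by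
    funext p
    simp
  constructor
  · intro h
    have h₁ : s.HalfFill V := s.halfFill_of_halfCell fun p hL => by
      simpa only [cell, src, if_pos hL] using h p hL.rel hL.ne_root
    have h₂ : s.swap.HalfFill (V ∘ Prod.swap) := s.swap.halfFill_of_halfCell fun p hL => by
      have hR : s.Rel p.swap := s.rel_swap.1 (by rw [Prod.swap_swap]; exact hL.rel)
      have hp : p.swap ≠ (none, none) := fun h => hL.ne_root (Prod.swap_injective h)
      have hL' := (s.swap_latePair_iff hR hp).1 (by rw [Prod.swap_swap]; exact hL)
      simpa only [cell, src, if_neg hL', hsum, Prod.swap_swap] using h p.swap hR hp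
    refine ⟨h₁.balanced h₂, h₂.balanced ?_⟩
    rw [swap_swap, hVV]
    exact h₁
  · rintro ⟨h₁, h₂⟩ p hR hp
    by_cases hL : s.LatePair p
    · simp only [cell, src, if_pos hL]
      exact hL.sum_halfCell h₁ h₂
    · simp only [cell, src, if_neg hL, hsum]
      refine ((s.swap_latePair_iff hR hp).2 hL).sum_halfCell h₂ ?_
      rw [swap_swap, hVV]
      exact h₁

theorem wellFounded_src :
    WellFounded fun q p => s.Rel p ∧ p ≠ (none, none) ∧ q ∈ s.src p := by
  refine ⟨fun p => ?_⟩
  by_cases hR : s.Rel p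
  · exact Subrelation.accessible (fun {q p} h => (s.of_mem_src h.1 h.2.1 h.2.2).2) (s.acc_of_rel hR)
  · exact Acc.intro _ fun q hq => absurd hq.1 hR

end BiForest

theorem Connected.symm {I J : Set (List ℕ)} (h : Connected I J) : Connected J I := by
  obtain ⟨u, hu, v, hv, huv⟩ := h
  exact ⟨v, hv, u, hu, huv.symm⟩

theorem Connected.of_prefix {I I' J : Set (List ℕ)} (h : Connected I J)
    (hI : ∀ u ∈ I, ∃ w ∈ I', w <+: u) : Connected I' J := by
  obtain ⟨u, hu, v, hv, huv⟩ := h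
  obtain ⟨w, hw, hwu⟩ := hI u hu
  refine ⟨w, hw, v, hv, ?_⟩
  rcases huv with huv | hvu
  · exact Or.inl (hwu.trans huv)
  · exact List.prefix_or_prefix_of_prefix hwu hvu

namespace EFG

variable {G : EFG}

theorem mem_actions {u : List ℕ} {a : ℕ} : a ∈ G.actions u ↔ u ++ [a] ∈ G.H := by
  simp [actions]

theorem InfoSet.sim {i : Fin 2} {I : Set (List ℕ)} (h : G.InfoSet i I) {u v : List ℕ}
    (hu : u ∈ I) (hv : v ∈ I) : G.sim i u v := by
  obtain ⟨w, -, rfl⟩ := h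
  exact G.sim_trans i u w v (G.sim_symm i w u hu) hv

theorem InfoSet.nonempty {i : Fin 2} {I : Set (List ℕ)} (h : G.InfoSet i I) : I.Nonempty := by
  obtain ⟨w, hw, rfl⟩ := h
  exact ⟨w, hw⟩

theorem InfoSet.mem_H {i : Fin 2} {I : Set (List ℕ)} (h : G.InfoSet i I) {u : List ℕ}
    (hu : u ∈ I) : u ∈ G.H := by
  obtain ⟨⟨a, ha⟩, -⟩ := G.sim_mem i u u (h.sim hu hu)
  exact G.prefix_closed _ _ (List.prefix_append u [a]) ha

variable (G) in
/-- The action set of an information set, empty for sets which are not information sets. -/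
noncomputable def infoActions (i : Fin 2) (I : Set (List ℕ)) : Finset ℕ :=
  if h : G.InfoSet i I then G.actions h.nonempty.choose else ∅

theorem InfoSet.infoActions_eq {i : Fin 2} {I : Set (List ℕ)} (h : G.InfoSet i I) {u : List ℕ}
    (hu : u ∈ I) : G.infoActions i I = G.actions u := by
  rw [infoActions, dif_pos h]
  ext a
  rw [mem_actions, mem_actions]
  exact G.sim_actions i _ _ (h.sim h.nonempty.choose_spec hu) a

theorem mem_infoActions {i : Fin 2} {I : Set (List ℕ)} {a : ℕ} :
    a ∈ G.infoActions i I ↔ G.InfoSet i I ∧ ∃ u ∈ I, u ++ [a] ∈ G.H := by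
  constructor
  · intro h
    have hI : G.InfoSet i I := by
      by_contra hI
      rw [infoActions, dif_neg hI] at h
      exact absurd h (Finset.notMem_empty a)
    obtain ⟨u, hu⟩ := hI.nonempty
    exact ⟨hI, u, hu, mem_actions.1 (hI.infoActions_eq hu ▸ h)⟩
  · rintro ⟨hI, u, hu, ha⟩
    rw [hI.infoActions_eq hu]
    exact mem_actions.2 ha

theorem infoActions_nonempty {i : Fin 2} {I : Set (List ℕ)} :
    (G.infoActions i I).Nonempty ↔ G.InfoSet i I := by
  constructor
  · rintro ⟨a, ha⟩
    exact (mem_infoActions.1 ha).1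
  · intro hI
    obtain ⟨u, hu⟩ := hI.nonempty
    obtain ⟨⟨a, ha⟩, -⟩ := G.sim_mem i u u (hI.sim hu hu)
    exact ⟨a, mem_infoActions.2 ⟨hI, u, hu, ha⟩⟩

theorem isSeq_some {i : Fin 2} {I : Set (List ℕ)} {a : ℕ} :
    G.IsSeq i (some (I, a)) ↔ a ∈ G.infoActions i I := by
  rw [mem_infoActions, IsSeq]
  constructor
  · rintro (h | ⟨I', a', h, h'⟩)
    · exact absurd h (Option.some_ne_none _)
    · obtain ⟨rfl, rfl⟩ := Prod.mk.inj (Option.some.inj h)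
      exact h'
  · exact fun h => Or.inr ⟨I, a, rfl, h⟩

theorem exists_of_mem_playerSeq {i : Fin 2} {u : List ℕ} {I : Set (List ℕ)} {a : ℕ}
    (h : (I, a) ∈ G.playerSeq i u) : G.InfoSet i I ∧ ∃ w ∈ I, w ++ [a] <+: u := by
  obtain ⟨k, hk, hk'⟩ := List.mem_filterMap.1 h
  rw [List.mem_range] at hk
  split_ifs at hk' with hown
  obtain ⟨rfl, rfl⟩ := Prod.mk.inj (Option.some.inj hk')
  have hsim := G.sim_refl i _ hown.1 hown.2
  refine ⟨⟨_, hsim, rfl⟩, u.take k, hsim, ?_⟩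
  rw [List.getD_eq_getElem _ _ hk, List.take_append_getElem]
  exact List.take_prefix _ _

theorem InfoSet.of_parentSeq (hpr : G.PerfectRecall) {i : Fin 2} {I I' : Set (List ℕ)} {a : ℕ}
    (hI : G.InfoSet i I) (h : G.parentSeq i I = some (I', a)) :
    G.InfoSet i I' ∧ ∀ u ∈ I, ∃ w ∈ I', w ++ [a] <+: u := by
  have hmem : ∀ u ∈ I, (I', a) ∈ G.playerSeq i u := by
    intro u hu
    have hex : ∃ u, u ∈ I := ⟨u, hu⟩
    rw [parentSeq, dif_pos hex, hpr i _ _ (hI.sim hex.choose_spec hu)] at h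
    exact List.mem_of_getLast? h
  obtain ⟨u, hu⟩ := hI.nonempty
  exact ⟨(exists_of_mem_playerSeq (hmem u hu)).1, fun u hu =>
    (exists_of_mem_playerSeq (hmem u hu)).2⟩

theorem InfoSet.mem_infoActions_of_parentSeq (hpr : G.PerfectRecall) {i : Fin 2}
    {I I' : Set (List ℕ)} {a : ℕ} (hI : G.InfoSet i I) (h : G.parentSeq i I = some (I', a)) :
    a ∈ G.infoActions i I' := by
  obtain ⟨hI', hpre⟩ := hI.of_parentSeq hpr h
  obtain ⟨u, hu⟩ := hI.nonempty
  obtain ⟨w, hw, hwu⟩ := hpre u hu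
  exact mem_infoActions.2 ⟨hI', w, hw, G.prefix_closed _ _ hwu (hI.mem_H hu)⟩

/-- The least length of a node of `I`. -/
noncomputable def infoDepth (I : Set (List ℕ)) : ℕ := sInf (List.length '' I)

theorem InfoSet.infoDepth_lt (hpr : G.PerfectRecall) {i : Fin 2} {I I' : Set (List ℕ)} {a : ℕ}
    (hI : G.InfoSet i I) (h : G.parentSeq i I = some (I', a)) : infoDepth I' < infoDepth I := by
  obtain ⟨u, hu, hlen⟩ := Nat.sInf_mem (hI.nonempty.image List.length)
  obtain ⟨w, hw, hwu⟩ := (hI.of_parentSeq hpr h).2 u hu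
  have h1 : infoDepth I' ≤ w.length := Nat.sInf_le ⟨w, hw, rfl⟩
  have h2 := hwu.length_le
  rw [List.length_append, List.length_singleton] at h2
  have h3 : infoDepth I = u.length := hlen.symm
  omega

theorem InfoSet.infoDepth_le {i : Fin 2} {I : Set (List ℕ)} (hI : G.InfoSet i I) :
    infoDepth I ≤ G.H.sup List.length := by
  obtain ⟨u, hu⟩ := hI.nonempty
  have h1 : infoDepth I ≤ u.length := Nat.sInf_le ⟨u, hu, rfl⟩
  exact h1.trans (Finset.le_sup (f := List.length) (hI.mem_H hu))

variable (G) in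
/-- `I` and `J` are connected information sets of the two players. -/
def InfoConn (I J : Set (List ℕ)) : Prop := G.InfoSet 0 I ∧ G.InfoSet 1 J ∧ Connected I J

theorem InfoConn.up₁ (hpr : G.PerfectRecall) {I I' J : Set (List ℕ)} {a : ℕ}
    (h : G.InfoConn I J) (hp : G.parentSeq 0 I = some (I', a)) : G.InfoConn I' J := by
  obtain ⟨hI', hpre⟩ := h.1.of_parentSeq hpr hp
  refine ⟨hI', h.2.1, h.2.2.of_prefix fun u hu => ?_⟩
  obtain ⟨w, hw, hwu⟩ := hpre u hu
  exact ⟨w, hw, (List.prefix_append w [a]).trans hwu⟩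

theorem InfoConn.up₂ (hpr : G.PerfectRecall) {I J J' : Set (List ℕ)} {b : ℕ}
    (h : G.InfoConn I J) (hp : G.parentSeq 1 J = some (J', b)) : G.InfoConn I J' := by
  obtain ⟨hJ', hpre⟩ := h.2.1.of_parentSeq hpr hp
  refine ⟨h.1, hJ', (h.2.2.symm.of_prefix fun u hu => ?_).symm⟩
  obtain ⟨w, hw, hwu⟩ := hpre u hu
  exact ⟨w, hw, (List.prefix_append w [b]).trans hwu⟩

variable (G) in
/-- `J` is connected to two sibling information sets of Player 1, one of which is an ancestor of
`I`. -/
def Branches (I J : Set (List ℕ)) : Prop :=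
  ∃ I₁ I₂, Relation.ReflTransGen (fun I' I => ∃ a, G.parentSeq 0 I = some (I', a)) I₁ I ∧
    I₁ ≠ I₂ ∧ G.parentSeq 0 I₁ = G.parentSeq 0 I₂ ∧ G.InfoConn I₂ J

theorem InfoConn.of_ancestor (hpr : G.PerfectRecall) {I I' J : Set (List ℕ)}
    (hanc : Relation.ReflTransGen (fun I' I => ∃ a, G.parentSeq 0 I = some (I', a)) I' I)
    (h : G.InfoConn I J) : G.InfoConn I' J := by
  induction hanc with
  | refl => exact h
  | tail _ hp ih =>
    obtain ⟨a, hp⟩ := hp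
    exact ih (h.up₁ hpr hp)

variable (G) in
/-- The information sets of the two players, oriented so that an information set of Player 2 which
is connected to several siblings is decided before these siblings. -/
noncomputable def biForest (hpr : G.PerfectRecall) (htf : G.TriangleFree) :
    BiForest (Set (List ℕ)) where
  A₁ := G.infoActions 0
  A₂ := G.infoActions 1
  p₁ := G.parentSeq 0
  p₂ := G.parentSeq 1
  C := G.InfoConn
  F := G.Branches
  d₁ := infoDepth
  d₂ := infoDepth
  N := G.H.sup List.length
  conn₁ h := infoActions_nonempty.2 h.1
  conn₂ h := infoActions_nonempty.2 h.2.1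
  parent₁ h hp := (infoActions_nonempty.1 h).mem_infoActions_of_parentSeq hpr hp
  parent₂ h hp := (infoActions_nonempty.1 h).mem_infoActions_of_parentSeq hpr hp
  depth₁ h hp := (infoActions_nonempty.1 h).infoDepth_lt hpr hp
  depth₂ h hp := (infoActions_nonempty.1 h).infoDepth_lt hpr hp
  bound₁ h := (infoActions_nonempty.1 h).infoDepth_le
  bound₂ h := (infoActions_nonempty.1 h).infoDepth_le
  up₁ h hp := h.up₁ hpr hp
  up₂ h hp := h.up₂ hpr hp
  mono₁ := by
    rintro I I' a J - hF hp ⟨I₁, I₂, hanc, h⟩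
    exact hF ⟨I₁, I₂, hanc.tail ⟨a, hp⟩, h⟩
  mono₂ := by
    rintro I J J' b - ⟨I₁, I₂, hanc, hne, hsib, hC⟩ hp
    exact ⟨I₁, I₂, hanc, hne, hsib, hC.up₂ hpr hp⟩
  uniq₁ := by
    intro I I' J _ hC' hF hp
    by_contra hne
    exact hF ⟨I, I', .refl, hne, hp, hC'⟩
  uniq₂ := by
    rintro I J J' hC hC' ⟨I₁, I₂, hanc, hne, hsib, hC₂⟩ hp
    by_contra hJ
    have h := hC.of_ancestor hpr hanc
    have h' := hC'.of_ancestor hpr hanc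
    exact htf ⟨I₁, I₂, J', J, h.1, hC₂.1, h'.2.1, h.2.1, hne, Ne.symm hJ, hsib, hp.symm,
      h'.2.2, hC₂.2.2, h.2.2⟩

theorem rel_biForest_iff (hpr : G.PerfectRecall) (htf : G.TriangleFree) {p : SeqP × SeqP} :
    (G.biForest hpr htf).Rel p ↔ G.RelPair p.1 p.2 := by
  have hnone : ∀ i, G.IsSeq i none := fun i => Or.inl rfl
  rcases p with ⟨_ | ⟨I, a⟩, _ | ⟨J, b⟩⟩
  · simp [BiForest.Rel, RelPair, hnone]
  · simp [BiForest.Rel, RelPair, hnone, isSeq_some, biForest]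
  · simp [BiForest.Rel, RelPair, hnone, isSeq_some, biForest]
  · change (G.InfoConn I J ∧ a ∈ G.infoActions 0 I ∧ b ∈ G.infoActions 1 J) ↔ _
    rw [RelPair, isSeq_some, isSeq_some]
    constructor
    · rintro ⟨hC, ha, hb⟩
      exact ⟨ha, hb, Or.inr (Or.inr ⟨I, a, J, b, rfl, rfl, hC.2.2⟩)⟩
    · rintro ⟨ha, hb, h | h | ⟨I', a', J', b', h₁, h₂, hC⟩⟩
      · exact absurd h (Option.some_ne_none _)
      · exact absurd h (Option.some_ne_none _)
      · obtain ⟨rfl, rfl⟩ := Prod.mk.inj (Option.some.inj h₁)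
        obtain ⟨rfl, rfl⟩ := Prod.mk.inj (Option.some.inj h₂)
        exact ⟨⟨(mem_infoActions.1 ha).1, (mem_infoActions.1 hb).1, hC⟩, ha, hb⟩

variable (G) in
theorem finite_isSeq (i : Fin 2) : {σ | G.IsSeq i σ}.Finite := by
  refine ((G.H.finite_toSet.image fun w : List ℕ =>
    (some ({v | G.sim i w.dropLast v}, w.getLastD 0) : SeqP)).insert none).subset ?_
  rintro σ (rfl | ⟨I, a, rfl, hI, u, hu, ha⟩)
  · exact Set.mem_insert _ _
  · refine Set.mem_insert_of_mem _ ⟨u ++ [a], ha, ?_⟩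
    have : {v | G.sim i u v} = I := by
      ext v
      constructor
      · intro hv
        obtain ⟨w, hw, rfl⟩ := hI
        exact G.sim_trans i w u v hu hv
      · exact fun hv => hI.sim hu hv
    simp [this]

variable (G) in
theorem finite_relPair : {p : SeqP × SeqP | G.RelPair p.1 p.2}.Finite :=
  ((G.finite_isSeq 0).prod (G.finite_isSeq 1)).subset fun _ hp => ⟨hp.1, hp.2.1⟩

theorem mem_VSF_iff (hpr : G.PerfectRecall) (htf : G.TriangleFree) {v : G.Idx → ℝ} :
    v ∈ G.VSF ↔ (∀ p, 0 ≤ v p) ∧ G.val v none none = 1 ∧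
      (G.biForest hpr htf).Balanced (fun p => G.val v p.1 p.2) ∧
      (G.biForest hpr htf).swap.Balanced ((fun p => G.val v p.1 p.2) ∘ Prod.swap) := by
  refine and_congr_right fun _ => and_congr_right fun _ => and_congr ?_ ?_
  · constructor
    · rintro h I (_ | ⟨J, b⟩) hR
      · have hI := infoActions_nonempty.1 hR
        obtain ⟨u, hu⟩ := hI.nonempty
        have := h I hI none (Or.inl rfl) (Or.inl rfl) u hu
        rwa [← hI.infoActions_eq hu] at this
      · have hI := hR.1.1
        obtain ⟨u, hu⟩ := hI.nonempty
        have := h I hI (some (J, b)) (isSeq_some.2 hR.2) (Or.inr ⟨J, b, rfl, hR.1.2.2⟩) u hu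
        rwa [← hI.infoActions_eq hu] at this
    · intro h I hI σ hσ hrel u hu
      rw [← hI.infoActions_eq hu]
      refine h I σ ?_
      rcases hrel with rfl | ⟨J, b, rfl, hC⟩
      · exact infoActions_nonempty.2 hI
      · have hb := isSeq_some.1 hσ
        exact ⟨⟨hI, (mem_infoActions.1 hb).1, hC⟩, hb⟩
  · constructor
    · rintro h J (_ | ⟨I, a⟩) hR
      · have hJ := infoActions_nonempty.1 hR
        obtain ⟨u, hu⟩ := hJ.nonempty
        have := h J hJ none (Or.inl rfl) (Or.inl rfl) u hu
        rwa [← hJ.infoActions_eq hu] at this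
      · have hJ := hR.1.2.1
        obtain ⟨u, hu⟩ := hJ.nonempty
        have := h J hJ (some (I, a)) (isSeq_some.2 hR.2) (Or.inr ⟨I, a, rfl, hR.1.2.2⟩) u hu
        rwa [← hJ.infoActions_eq hu] at this
    · intro h J hJ σ hσ hrel u hu
      rw [← hJ.infoActions_eq hu]
      refine h J σ ?_
      rcases hrel with rfl | ⟨I, a, rfl, hC⟩
      · exact infoActions_nonempty.2 hJ
      · have ha := isSeq_some.1 hσ
        exact ⟨⟨(mem_infoActions.1 ha).1, hJ, hC⟩, ha⟩

end EFG

/-- In a two-player perfect-recall triangle-free extensive-form game,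
the von Stengel–Forges polytope `𝒱` admits a scaled-extension-based decomposition:
there are `n` steps of positive dimensions `dims k`, with `1 + ∑ dims k = |Σ₁ ⇌ Σ₂|`,
each set `𝒳ₖ` being either a standard probability simplex or the singleton `{1} ⊆ ℝ`,
each `hₖ` linear and nonnegative on `𝒫ₖ`, together with a bijection `e` between the
relevant sequence pairs and the coordinates, such that the reindexed copy of `𝒱`
equals the final polytope `𝒫ₙ` of the chain. -/
theorem VSF_scaledExt_decomposition (G : EFG) (hpr : G.PerfectRecall)
    (htf : G.TriangleFree) :
    ∃ (n : ℕ) (dims : ℕ → ℕ) (X : (k : ℕ) → Set (Fin (dims k) → ℝ))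
      (h : (k : ℕ) → (Fin (cumdim dims k) → ℝ) → ℝ)
      (e : G.Idx ≃ Fin (cumdim dims n)),
      (∀ k < n, 0 < dims k) ∧
      cumdim dims n = Nat.card G.Idx ∧
      (∀ k < n, X k = stdSimplex ℝ (Fin (dims k)) ∨
        (dims k = 1 ∧ X k = {fun _ => (1 : ℝ)})) ∧
      (∀ k < n, IsLinearMap ℝ (h k) ∧ ∀ x ∈ seChain dims X h k, 0 ≤ h k x) ∧
      seChain dims X h n = {w | ∃ v ∈ G.VSF, ∀ p : G.Idx, w (e p) = v p} := by
  set s := G.biForest hpr htf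
  set r : SeqP × SeqP := (none, none)
  have hrel : ∀ {p}, s.Rel p ↔ G.RelPair p.1 p.2 := EFG.rel_biForest_iff hpr htf
  have hr : s.Rel r := trivial
  have hmem : ∀ {p}, p ∈ G.finite_relPair.toFinset ↔ s.Rel p := by
    intro p
    rw [Set.Finite.mem_toFinset, hrel]
    exact Iff.rfl
  obtain ⟨n, f, hf, hdisj, hsrc, hcover⟩ :=
    exists_cell_enumeration G.finite_relPair.toFinset r s.cell s.src
      (fun p hp hpr' => s.mem_cell_self (hmem.1 hp) hpr')
      (fun p hp hpr' q hq => by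
        obtain ⟨h1, h2, h3, -⟩ := s.of_mem_cell (hmem.1 hp) hpr' hq
        exact ⟨hmem.2 h1, h2, h3⟩)
      (fun p hp hpr' q hq => hmem.2 (s.of_mem_src (hmem.1 hp) hpr' hq).1)
      (by simpa only [hmem] using s.wellFounded_src)
  simp only [hmem] at hf hcover
  set B : ℕ → Finset (SeqP × SeqP) := fun k => s.cell (f k)
  set S : ℕ → Finset (SeqP × SeqP) := fun k => s.src (f k)
  have hne : ∀ i < n, (B i).Nonempty := fun i hi =>
    ⟨f i, s.mem_cell_self (hf i hi).1 (hf i hi).2⟩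
  have hchain := fun k (hk : k ≤ n) => mem_seChain_iff (r := r) (B := B) (S := S) (k := k)
    (fun i hi => hne i (hi.trans_le hk)) (fun i hi => hdisj i (hi.trans_le hk))
    (fun i hi => hsrc i (hi.trans_le hk))
  have hinj : ∀ k ≤ n, Function.Injective (chainCoord r B k) := fun k hk =>
    injective_chainCoord fun i hi => hdisj i (hi.trans_le hk)
  have hrange : ∀ p, p ∈ Set.range (chainCoord r B n) ↔ s.Rel p := by
    intro p
    rw [range_chainCoord]
    constructor
    · rintro (rfl | ⟨j, hj, hp⟩)
      · exact hr
      · exact (s.of_mem_cell (hf j hj).1 (hf j hj).2 hp).1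
    · exact fun hp => or_iff_not_imp_left.2 fun hp' => hcover p hp hp'
  have heqs : ∀ V : SeqP × SeqP → ℝ, (∀ i < n, ∑ p ∈ B i, V p = ∑ p ∈ S i, V p) ↔
      s.Balanced V ∧ s.swap.Balanced (V ∘ Prod.swap) := by
    intro V
    rw [← s.sum_cell_iff]
    constructor
    · intro h p hp hp'
      obtain ⟨j, hj, hpj⟩ := hcover p hp hp'
      obtain ⟨-, -, h1, h2⟩ := s.of_mem_cell (hf j hj).1 (hf j hj).2 hpj
      rw [h1, h2]
      exact h j hj
    · exact fun h i hi => h _ (hf i hi).1 (hf i hi).2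
  let c : Fin (cumdim (fun k => (B k).card) n) → G.Idx := fun i =>
    ⟨chainCoord r B n i, hrel.1 ((hrange _).1 ⟨i, rfl⟩)⟩
  have hc : Function.Bijective c := by
    refine ⟨fun i j hij => hinj n le_rfl (congrArg Subtype.val hij), fun p => ?_⟩
    obtain ⟨i, hi⟩ := (hrange p.1).2 (hrel.2 p.2)
    exact ⟨i, Subtype.ext hi⟩
  let e : G.Idx ≃ Fin (cumdim (fun k => (B k).card) n) := (Equiv.ofBijective c hc).symm
  have he : ∀ p, chainCoord r B n (e p) = p.1 := fun p =>
    congrArg Subtype.val ((Equiv.ofBijective c hc).apply_symm_apply p)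
  refine ⟨n, fun k => (B k).card, fun k => stdSimplex ℝ (Fin (B k).card), chainFun r B S, e,
    fun k hk => Finset.card_pos.2 (hne k hk), ?_, fun k _ => Or.inl rfl, fun k hk => ?_, ?_⟩
  · rw [Nat.card_congr e, Nat.card_fin]
  · refine ⟨isLinearMap_chainFun r B S k, fun x hx => ?_⟩
    obtain ⟨v, hv, -, -, rfl⟩ := (hchain k hk.le x).1 hx
    rw [chainFun_comp (hinj k hk.le) fun p hp => ?_]
    · exact Finset.sum_nonneg fun p _ => hv p
    · rw [range_chainCoord]
      exact hsrc k hk p hp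
  · ext w
    rw [hchain n le_rfl w]
    constructor
    · rintro ⟨V, hV0, hVr, hVeq, rfl⟩
      have hval : ∀ p, s.Rel p → G.val (fun p => V p.1) p.1 p.2 = V p := fun p hp => by
        rw [EFG.val, dif_pos (hrel.1 hp)]
      refine ⟨fun p => V p.1, (EFG.mem_VSF_iff hpr htf).2
        ⟨fun p => hV0 _, (hval r hr).trans hVr, (heqs _).1 fun i hi => ?_⟩, fun p => ?_⟩
      · rw [Finset.sum_congr rfl fun p hp =>
            hval p (s.of_mem_cell (hf i hi).1 (hf i hi).2 hp).1,
          Finset.sum_congr rfl fun p hp => hval p (s.of_mem_src (hf i hi).1 (hf i hi).2 hp).1]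
        exact hVeq i hi
      · rw [Function.comp_apply, he]
    · rintro ⟨v, hv, hw⟩
      obtain ⟨hv0, hvr, hbal⟩ := (EFG.mem_VSF_iff hpr htf).1 hv
      refine ⟨fun p => G.val v p.1 p.2, fun p => ?_, hvr, (heqs _).2 hbal, ?_⟩
      · simp only [EFG.val]
        split_ifs
        · exact hv0 _
        · exact le_rfl
      · funext i
        obtain ⟨p, rfl⟩ := e.surjective i
        rw [hw, Function.comp_apply, he, EFG.val, dif_pos p.2]
end

section
/- Let S ⊆ ℝⁿ and T ⊆ ℝᵐ be finite nonempty sets, let 𝒳 be the convex hull of S and 𝒴 the convex hull of T, and let h : ℝⁿ → ℝ be affine with h(x) ≥ 0 for all x ∈ 𝒳. Then the scaled extension 𝒳 ⋉ʰ 𝒴 is a convex hull of a finite set (hence a compact convex polytope), its set of extreme points is nonempty, and every extreme point of 𝒳 ⋉ʰ 𝒴 is of the form (x, h(x) • y) where x is an extreme point of 𝒳 and y is an extreme point of 𝒴. -/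
/-- The scaled extension `𝒳 ⋉ʰ 𝒴 = {(x, h(x) • y) : x ∈ 𝒳, y ∈ 𝒴}` of a set `𝒳`
with a set `𝒴` via `h`. -/
def scaledExt {α β : Type*} [SMul ℝ β] (X : Set α) (Y : Set β) (h : α → ℝ) :
    Set (α × β) :=
  {p | ∃ x ∈ X, ∃ y ∈ Y, p = (x, h x • y)}

/-- `h` is affine: the sum of a linear function and a constant. -/
def IsAffineFn {α : Type*} [AddCommGroup α] [Module ℝ α] (h : α → ℝ) : Prop :=
  ∃ (l : α →ₗ[ℝ] ℝ) (c : ℝ), ∀ x, h x = l x + c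

theorem IsAffineFn.apply_combo {α : Type*} [AddCommGroup α] [Module ℝ α] {h : α → ℝ}
    (hh : IsAffineFn h) {a b : ℝ} (hab : a + b = 1) (x y : α) :
    h (a • x + b • y) = a * h x + b * h y := by
  obtain ⟨l, c, hl⟩ := hh
  simp only [hl, map_add, map_smul, smul_eq_mul]
  linear_combination (-c) * hab

theorem mk_mem_scaledExt {α β : Type*} [SMul ℝ β] {X : Set α} {Y : Set β} {h : α → ℝ}
    {x : α} {y : β} (hx : x ∈ X) (hy : y ∈ Y) :
    (x, h x • y) ∈ scaledExt X Y h :=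
  ⟨x, hx, y, hy, rfl⟩

theorem finite_scaledExt {α β : Type*} [SMul ℝ β] {S : Set α} {T : Set β} {h : α → ℝ}
    (hS : S.Finite) (hT : T.Finite) :
    (scaledExt S T h).Finite := by
  refine ((hS.prod hT).image fun q => (q.1, h q.1 • q.2)).subset ?_
  rintro _ ⟨s, hs, t, ht, rfl⟩
  exact ⟨(s, t), ⟨hs, ht⟩, rfl⟩

section ScaledExt

variable {α β : Type*} [AddCommGroup α] [Module ℝ α] [AddCommGroup β] [Module ℝ β]
  {X : Set α} {Y : Set β} {h : α → ℝ}

theorem IsAffineFn.mk_smul_combo_left (hh : IsAffineFn h) {a b : ℝ} (hab : a + b = 1)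
    (x₁ x₂ : α) (y : β) :
    (a • x₁ + b • x₂, h (a • x₁ + b • x₂) • y) = a • (x₁, h x₁ • y) + b • (x₂, h x₂ • y) := by
  rw [hh.apply_combo hab]
  simp only [Prod.smul_mk, Prod.mk_add_mk, add_smul, mul_smul]

theorem mk_smul_combo_right (h : α → ℝ) {a b : ℝ} (hab : a + b = 1) (x : α) (y₁ y₂ : β) :
    (x, h x • (a • y₁ + b • y₂)) = a • (x, h x • y₁) + b • (x, h x • y₂) := by
  simp only [Prod.smul_mk, Prod.mk_add_mk, ← add_smul, hab, one_smul, smul_add,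
    smul_comm (h x)]

open scoped Pointwise in
theorem convex_scaledExt (hX : Convex ℝ X) (hY : Convex ℝ Y) (hh : IsAffineFn h)
    (hnn : ∀ x ∈ X, 0 ≤ h x) : Convex ℝ (scaledExt X Y h) := by
  rintro _ ⟨x₁, hx₁, y₁, hy₁, rfl⟩ _ ⟨x₂, hx₂, y₂, hy₂, rfl⟩ a b ha hb hab
  have key : (a * h x₁) • y₁ + (b * h x₂) • y₂ ∈ (a * h x₁ + b * h x₂) • Y := by
    rw [hY.add_smul (mul_nonneg ha (hnn _ hx₁)) (mul_nonneg hb (hnn _ hx₂))]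
    exact Set.add_mem_add (Set.smul_mem_smul_set hy₁) (Set.smul_mem_smul_set hy₂)
  obtain ⟨y, hy, hye⟩ := key
  refine ⟨a • x₁ + b • x₂, hX hx₁ hx₂ ha hb hab, y, hy, ?_⟩
  rw [hh.apply_combo hab]
  simp only [Prod.smul_mk, Prod.mk_add_mk, smul_smul]
  exact Prod.ext rfl hye.symm

/-- The scaled extension of two convex hulls is the convex hull of the scaled extension of
the generating sets. -/
theorem scaledExt_convexHull {S : Set α} {T : Set β} (hh : IsAffineFn h)
    (hnn : ∀ x ∈ convexHull ℝ S, 0 ≤ h x) :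
    scaledExt (convexHull ℝ S) (convexHull ℝ T) h = convexHull ℝ (scaledExt S T h) := by
  apply subset_antisymm
  · rintro _ ⟨x, hx, y, hy, rfl⟩
    have hC := convex_convexHull ℝ (scaledExt S T h)
    have hS : ∀ s ∈ S, ∀ y ∈ convexHull ℝ T, (s, h s • y) ∈ convexHull ℝ (scaledExt S T h) := by
      intro s hs
      refine convexHull_min (t := {y | (s, h s • y) ∈ convexHull ℝ (scaledExt S T h)})
        (fun t ht => subset_convexHull ℝ _ (mk_mem_scaledExt hs ht)) ?_
      intro y₁ h₁ y₂ h₂ a b ha hb hab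
      rw [Set.mem_ofPred_eq, mk_smul_combo_right h hab]
      exact hC h₁ h₂ ha hb hab
    refine convexHull_min (t := {x | (x, h x • y) ∈ convexHull ℝ (scaledExt S T h)})
      (fun s hs => hS s hs y hy) ?_ hx
    intro x₁ h₁ x₂ h₂ a b ha hb hab
    rw [Set.mem_ofPred_eq, hh.mk_smul_combo_left hab]
    exact hC h₁ h₂ ha hb hab
  · refine convexHull_min ?_
      (convex_scaledExt (convex_convexHull ℝ S) (convex_convexHull ℝ T) hh hnn)
    rintro _ ⟨s, hs, t, ht, rfl⟩
    exact mk_mem_scaledExt (subset_convexHull ℝ _ hs) (subset_convexHull ℝ _ ht)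

/-- If `(x, h x • y)` is extreme in the scaled extension, then `x` is extreme. -/
theorem left_mem_extremePoints_of_scaledExt (hh : IsAffineFn h) {x : α} {y : β} (hx : x ∈ X)
    (hy : y ∈ Y) (hp : (x, h x • y) ∈ (scaledExt X Y h).extremePoints ℝ) :
    x ∈ X.extremePoints ℝ := by
  refine mem_extremePoints_iff_left.2 ⟨hx, ?_⟩
  rintro x₁ hx₁ x₂ hx₂ ⟨a, b, ha, hb, hab, rfl⟩
  exact congrArg Prod.fst ((mem_extremePoints_iff_left.1 hp).2 _ (mk_mem_scaledExt hx₁ hy) _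
    (mk_mem_scaledExt hx₂ hy) ⟨a, b, ha, hb, hab, (hh.mk_smul_combo_left hab x₁ x₂ y).symm⟩)

/-- If `(x, h x • y)` is extreme in the scaled extension and `h x ≠ 0`, then `y` is extreme. -/
theorem right_mem_extremePoints_of_scaledExt {x : α} {y : β} (hx : x ∈ X) (hy : y ∈ Y)
    (h0 : h x ≠ 0) (hp : (x, h x • y) ∈ (scaledExt X Y h).extremePoints ℝ) :
    y ∈ Y.extremePoints ℝ := by
  refine mem_extremePoints_iff_left.2 ⟨hy, ?_⟩
  rintro y₁ hy₁ y₂ hy₂ ⟨a, b, ha, hb, hab, rfl⟩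
  exact smul_right_injective β h0 (congrArg Prod.snd ((mem_extremePoints_iff_left.1 hp).2 _
    (mk_mem_scaledExt hx hy₁) _ (mk_mem_scaledExt hx hy₂)
    ⟨a, b, ha, hb, hab, (mk_smul_combo_right h hab x y₁ y₂).symm⟩))

end ScaledExt

/-- If `𝒳 = conv S` and `𝒴 = conv T` with `S, T` finite and nonempty,
and `h` is affine and nonnegative on `𝒳`, then `𝒳 ⋉ʰ 𝒴` is the convex hull of a finite
set, its set of extreme points is nonempty, and every extreme point of `𝒳 ⋉ʰ 𝒴` has the
form `(x, h(x) • y)` with `x` an extreme point of `𝒳` and `y` an extreme point of `𝒴`. -/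
theorem scaledExt_polytope {n m : ℕ} (S : Set (Fin n → ℝ)) (T : Set (Fin m → ℝ))
    (hSfin : S.Finite) (hTfin : T.Finite) (hSne : S.Nonempty) (hTne : T.Nonempty)
    (h : (Fin n → ℝ) → ℝ) (haff : IsAffineFn h)
    (hnn : ∀ x ∈ convexHull ℝ S, 0 ≤ h x) :
    (∃ F : Set ((Fin n → ℝ) × (Fin m → ℝ)), F.Finite ∧
        scaledExt (convexHull ℝ S) (convexHull ℝ T) h = convexHull ℝ F) ∧
    ((scaledExt (convexHull ℝ S) (convexHull ℝ T) h).extremePoints ℝ).Nonempty ∧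
    (∀ p ∈ (scaledExt (convexHull ℝ S) (convexHull ℝ T) h).extremePoints ℝ,
      ∃ x ∈ (convexHull ℝ S).extremePoints ℝ, ∃ y ∈ (convexHull ℝ T).extremePoints ℝ,
        p = (x, h x • y)) := by
  have hText : ((convexHull ℝ T).extremePoints ℝ).Nonempty :=
    (hTfin.isCompact_convexHull ℝ).extremePoints_nonempty hTne.convexHull
  have hEq := scaledExt_convexHull (T := T) haff hnn
  have hF : (scaledExt S T h).Finite := finite_scaledExt hSfin hTfin
  refine ⟨⟨_, hF, hEq⟩, ?_, ?_⟩
  · obtain ⟨s, hs⟩ := hSne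
    obtain ⟨t, ht⟩ := hTne
    rw [hEq]
    exact (hF.isCompact_convexHull ℝ).extremePoints_nonempty
      (Set.Nonempty.convexHull ⟨_, mk_mem_scaledExt hs ht⟩)
  · intro p hp
    obtain ⟨x, hx, y, hy, rfl⟩ := hp.1
    refine ⟨x, left_mem_extremePoints_of_scaledExt haff hx hy hp, ?_⟩
    by_cases h0 : h x = 0
    · obtain ⟨z, hz⟩ := hText
      exact ⟨z, hz, by simp [h0]⟩
    · exact ⟨y, right_mem_extremePoints_of_scaledExt hx hy h0 hp, rfl⟩
end

section
/- Let S ⊆ ℝⁿ and T ⊆ ℝᵐ be finite sets with T nonempty, and let h : ℝⁿ → ℝ be affine with h(x) ≥ 0 for all x in the convex hull of S. Then the scaled extension of the convex hull of S with the convex hull of T via h equals the convex hull of the finite set {(s, h(s) • t) : s ∈ S, t ∈ T}; that is, conv(S) ⋉ʰ conv(T) = conv({(s, h(s) • t) : s ∈ S, t ∈ T}). -/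
theorem IsAffineFn.map_convexComb {α : Type*} [AddCommGroup α] [Module ℝ α] {h : α → ℝ}
    (haff : IsAffineFn h) {a b : ℝ} (hab : a + b = 1) (x y : α) :
    h (a • x + b • y) = a * h x + b * h y := by
  obtain ⟨l, c, hl⟩ := haff
  simp only [hl, map_add, map_smul, smul_eq_mul]
  linear_combination (-c) * hab

open scoped Pointwise in
theorem Convex.scaledExt {α β : Type*} [AddCommGroup α] [Module ℝ α] [AddCommGroup β]
    [Module ℝ β] {X : Set α} {Y : Set β} {h : α → ℝ} (hX : Convex ℝ X) (hY : Convex ℝ Y)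
    (haff : IsAffineFn h) (hnn : ∀ x ∈ X, 0 ≤ h x) : Convex ℝ (scaledExt X Y h) := by
  rintro _ ⟨x₁, hx₁, y₁, hy₁, rfl⟩ _ ⟨x₂, hx₂, y₂, hy₂, rfl⟩ a b ha hb hab
  obtain ⟨y, hy, hyeq⟩ : (a * h x₁) • y₁ + (b * h x₂) • y₂ ∈ (a * h x₁ + b * h x₂) • Y := by
    rw [hY.add_smul (mul_nonneg ha (hnn _ hx₁)) (mul_nonneg hb (hnn _ hx₂))]
    exact Set.add_mem_add (Set.smul_mem_smul_set hy₁) (Set.smul_mem_smul_set hy₂)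
  refine ⟨a • x₁ + b • x₂, hX hx₁ hx₂ ha hb hab, y, hy, ?_⟩
  simp only at hyeq
  rw [haff.map_convexComb hab, hyeq]
  simp [mul_smul]

theorem scaledExt_mono {α β : Type*} [SMul ℝ β] {X X' : Set α} {Y Y' : Set β} (h : α → ℝ)
    (hX : X ⊆ X') (hY : Y ⊆ Y') : scaledExt X Y h ⊆ scaledExt X' Y' h := by
  rintro _ ⟨x, hx, y, hy, rfl⟩
  exact ⟨x, hX hx, y, hY hy, rfl⟩

theorem scaledExt_convexHull_subset {α β : Type*} [AddCommGroup α] [Module ℝ α]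
    [AddCommGroup β] [Module ℝ β] (S : Set α) (T : Set β) {h : α → ℝ} (haff : IsAffineFn h) :
    scaledExt (convexHull ℝ S) (convexHull ℝ T) h ⊆ convexHull ℝ (scaledExt S T h) := by
  have hC : Convex ℝ (convexHull ℝ (scaledExt S T h)) := convex_convexHull ℝ _
  have hT : ∀ t ∈ T, convexHull ℝ S ⊆ {x | (x, h x • t) ∈ convexHull ℝ (scaledExt S T h)} := by
    intro t ht
    refine convexHull_min (fun s hs => subset_convexHull ℝ _ ⟨s, hs, t, ht, rfl⟩) ?_
    intro x hx y hy a b ha hb hab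
    have hxy := hC hx hy ha hb hab
    simpa [haff.map_convexComb hab, add_smul, mul_smul] using hxy
  rintro _ ⟨x, hx, y, hy, rfl⟩
  refine convexHull_min (t := {y | (x, h x • y) ∈ convexHull ℝ (scaledExt S T h)})
    (fun t ht => hT t ht hx) ?_ hy
  intro y hy z hz a b ha hb hab
  have hyz := hC hy hz ha hb hab
  simpa [← add_smul, hab, smul_add, smul_comm (h x)] using hyz

/-- For finite `S` and finite nonempty `T`, and `h` affine and
nonnegative on `conv S`, one has
`conv(S) ⋉ʰ conv(T) = conv {(s, h(s) • t) : s ∈ S, t ∈ T}`. -/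
theorem scaledExt_convexHull_eq {n m : ℕ} (S : Set (Fin n → ℝ)) (T : Set (Fin m → ℝ))
    (hSfin : S.Finite) (hTfin : T.Finite) (hTne : T.Nonempty)
    (h : (Fin n → ℝ) → ℝ) (haff : IsAffineFn h)
    (hnn : ∀ x ∈ convexHull ℝ S, 0 ≤ h x) :
    scaledExt (convexHull ℝ S) (convexHull ℝ T) h =
      convexHull ℝ {p : (Fin n → ℝ) × (Fin m → ℝ) | ∃ s ∈ S, ∃ t ∈ T, p = (s, h s • t)} := by
  exact (scaledExt_convexHull_subset S T haff).antisymm <|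
    convexHull_min (scaledExt_mono h (subset_convexHull ℝ S) (subset_convexHull ℝ T))
      ((convex_convexHull ℝ S).scaledExt (convex_convexHull ℝ T) haff hnn)
end

section
/- Let 𝒳 ⊆ ℝⁿ and 𝒴 ⊆ ℝᵐ be convex sets and let h : ℝⁿ → ℝ be affine with h(x) ≥ 0 for all x ∈ 𝒳. Then the scaled extension 𝒳 ⋉ʰ 𝒴 is a convex subset of ℝⁿ × ℝᵐ. -/
/-- The scaled extension of convex sets via an affine function that is
nonnegative on the first set is convex. -/
theorem scaledExt_convex {n m : ℕ} (X : Set (Fin n → ℝ)) (Y : Set (Fin m → ℝ))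
    (hX : Convex ℝ X) (hY : Convex ℝ Y)
    (h : (Fin n → ℝ) → ℝ) (haff : IsAffineFn h) (hnn : ∀ x ∈ X, 0 ≤ h x) :
    Convex ℝ (scaledExt X Y h) := by
  obtain ⟨l, c, hl⟩ := haff
  rintro _ ⟨x₁, hx₁, y₁, hy₁, rfl⟩ _ ⟨x₂, hx₂, y₂, hy₂, rfl⟩ a b ha hb hab
  have hcomb : h (a • x₁ + b • x₂) = a * h x₁ + b * h x₂ := by
    simp only [hl, map_add, map_smul, smul_eq_mul]
    linear_combination (-c) * hab
  obtain ⟨y, hy, hy_eq⟩ := hY.exists_mem_add_smul_eq hy₁ hy₂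
    (mul_nonneg ha (hnn x₁ hx₁)) (mul_nonneg hb (hnn x₂ hx₂))
  refine ⟨a • x₁ + b • x₂, hX hx₁ hx₂ ha hb hab, y, hy, ?_⟩
  rw [hcomb, hy_eq, Prod.smul_mk, Prod.smul_mk, Prod.mk_add_mk, smul_smul, smul_smul]
end

section
/- Let S ⊆ ℝⁿ be a finite set, let 𝒳 be its convex hull, and let h : ℝⁿ → ℝ be affine with h(x) ≥ 0 for all x ∈ 𝒳. Suppose that every extreme point of 𝒳 has all coordinates in ℤ and that h maps every extreme point of 𝒳 to an integer. Then, for every s ∈ ℕ, every extreme point of the scaled extension 𝒳 ⋉ʰ Δˢ has all coordinates in ℤ. -/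
/-- Extreme points of a scaled extension via an affine function project to extreme points
of the base set. -/
theorem fst_mem_extremePoints_of_scaledExt {α β : Type*} [AddCommGroup α] [Module ℝ α]
    [AddCommGroup β] [Module ℝ β] {X : Set α} {Y : Set β} {h : α → ℝ} (haff : IsAffineFn h)
    {x : α} {y : β} (hx : x ∈ X) (hy : y ∈ Y)
    (hp : (x, h x • y) ∈ (scaledExt X Y h).extremePoints ℝ) : x ∈ X.extremePoints ℝ := by
  obtain ⟨l, c, hl⟩ := haff
  refine ⟨hx, fun a ha b hb hab => ?_⟩
  obtain ⟨s, t, hs, ht, hst, rfl⟩ := hab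
  have heq : s * h a + t * h b = h (s • a + t • b) := by
    simp only [hl, map_add, map_smul, smul_eq_mul]
    linear_combination c * hst
  have := hp.2 (x₁ := (a, h a • y)) ⟨a, ha, y, hy, rfl⟩ (x₂ := (b, h b • y)) ⟨b, hb, y, hy, rfl⟩
    ⟨s, t, hs, ht, hst, by
      simp only [Prod.smul_mk, Prod.mk_add_mk, smul_smul, ← add_smul, heq]⟩
  exact congrArg Prod.fst this

/-- At an extreme point `(x, h x • y)` of a scaled extension with `h x ≠ 0`, the point `y` is
extreme. -/
theorem mem_extremePoints_of_scaledExt {α β : Type*} [AddCommGroup α] [Module ℝ α]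
    [AddCommGroup β] [Module ℝ β] {X : Set α} {Y : Set β} {h : α → ℝ}
    {x : α} {y : β} (hx : x ∈ X) (hy : y ∈ Y) (hx0 : h x ≠ 0)
    (hp : (x, h x • y) ∈ (scaledExt X Y h).extremePoints ℝ) : y ∈ Y.extremePoints ℝ := by
  refine ⟨hy, fun a ha b hb hab => ?_⟩
  obtain ⟨s, t, hs, ht, hst, rfl⟩ := hab
  have := hp.2 (x₁ := (x, h x • a)) ⟨x, hx, a, ha, rfl⟩ (x₂ := (x, h x • b)) ⟨x, hx, b, hb, rfl⟩
    ⟨s, t, hs, ht, hst, by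
      simp only [Prod.smul_mk, Prod.mk_add_mk, ← add_smul, hst, one_smul, smul_add,
        smul_comm (h x)]⟩
  exact smul_right_injective β hx0 (congrArg Prod.snd this)

/-- Every extreme point of the standard simplex is a standard basis vector. -/
theorem exists_eq_single_of_mem_extremePoints_stdSimplex {ι : Type*} [Fintype ι] [DecidableEq ι]
    {y : ι → ℝ} (hy : y ∈ (stdSimplex ℝ ι).extremePoints ℝ) : ∃ i, y = Pi.single i 1 := by
  rw [← convexHull_rangle_single_eq_stdSimplex] at hy
  obtain ⟨i, rfl⟩ := extremePoints_convexHull_subset hy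
  exact ⟨i, rfl⟩

/-- Let `𝒳 = conv S` with `S` finite, and let `h` be affine,
nonnegative on `𝒳`, with integer extreme-point values, and suppose every extreme point
of `𝒳` has integer coordinates.  Then for every `s : ℕ`, every extreme point of
`𝒳 ⋉ʰ Δˢ` has integer coordinates. -/
theorem scaledExt_stdSimplex_integral {n : ℕ} (S : Set (Fin n → ℝ)) (hSfin : S.Finite)
    (h : (Fin n → ℝ) → ℝ) (haff : IsAffineFn h)
    (hnn : ∀ x ∈ convexHull ℝ S, 0 ≤ h x)
    (hint : ∀ x ∈ (convexHull ℝ S).extremePoints ℝ, ∀ i, ∃ z : ℤ, x i = (z : ℝ))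
    (hhint : ∀ x ∈ (convexHull ℝ S).extremePoints ℝ, ∃ z : ℤ, h x = (z : ℝ)) :
    ∀ s : ℕ,
      ∀ p ∈ (scaledExt (convexHull ℝ S) (stdSimplex ℝ (Fin s)) h).extremePoints ℝ,
        (∀ i, ∃ z : ℤ, p.1 i = (z : ℝ)) ∧ (∀ j, ∃ z : ℤ, p.2 j = (z : ℝ)) := by
  intro s p hp
  obtain ⟨x, hx, y, hy, rfl⟩ := hp.1
  have hxe := fst_mem_extremePoints_of_scaledExt haff hx hy hp
  refine ⟨hint x hxe, fun j => ?_⟩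
  by_cases hx0 : h x = 0
  · exact ⟨0, by simp [hx0]⟩
  · obtain ⟨z, hz⟩ := hhint x hxe
    obtain ⟨i, rfl⟩ := exists_eq_single_of_mem_extremePoints_stdSimplex
      (mem_extremePoints_of_scaledExt hx hy hx0 hp)
    exact ⟨z * Pi.single (M := fun _ => ℤ) i 1 j, by
      by_cases hij : j = i <;> simp [hz, hij]⟩
end

section
/- Let S ⊆ ℝⁿ be a finite set, let 𝒳 be its convex hull, and let h : ℝⁿ → ℝ be affine with h(x) ≥ 0 for all x ∈ 𝒳. Suppose that every extreme point of 𝒳 has all coordinates in ℤ and that h maps every extreme point of 𝒳 to an integer. Then every extreme point of the set {(x, h(x)) : x ∈ 𝒳} ⊆ ℝⁿ × ℝ (the scaled extension 𝒳 ⋉ʰ {1}) has all coordinates in ℤ. -/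
theorem IsAffineFn.map_openSegment {α : Type*} [AddCommGroup α] [Module ℝ α] {h : α → ℝ}
    (haff : IsAffineFn h) {x y z : α} (hx : x ∈ openSegment ℝ y z) :
    (x, h x) ∈ openSegment ℝ (y, h y) (z, h z) := by
  obtain ⟨l, c, hl⟩ := haff
  obtain ⟨a, b, ha, hb, hab, rfl⟩ := hx
  refine ⟨a, b, ha, hb, hab, Prod.ext rfl ?_⟩
  simp only [hl, Prod.smul_mk, Prod.mk_add_mk, smul_eq_mul, map_add, map_smul]
  linear_combination c * hab

/-- An extreme point of the graph of an affine function over `X` lies over an extreme point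
of `X`. -/
theorem IsAffineFn.exists_mem_extremePoints_of_graph {α : Type*} [AddCommGroup α] [Module ℝ α]
    {h : α → ℝ} (haff : IsAffineFn h) {X : Set α} {p : α × ℝ}
    (hp : p ∈ {p : α × ℝ | ∃ x ∈ X, p = (x, h x)}.extremePoints ℝ) :
    ∃ x ∈ X.extremePoints ℝ, p = (x, h x) := by
  rw [mem_extremePoints_iff_left] at hp
  obtain ⟨⟨x, hxX, rfl⟩, hext⟩ := hp
  refine ⟨x, mem_extremePoints_iff_left.2 ⟨hxX, fun y hy z hz hxyz => ?_⟩, rfl⟩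
  exact congrArg Prod.fst
    (hext (y, h y) ⟨y, hy, rfl⟩ (z, h z) ⟨z, hz, rfl⟩ (haff.map_openSegment hxyz))

/-- Let `𝒳 = conv S` with `S` finite, and let `h` be affine,
nonnegative on `𝒳`, with integer extreme-point values, and suppose every extreme point
of `𝒳` has integer coordinates.  Then every extreme point of
`{(x, h(x)) : x ∈ 𝒳} = 𝒳 ⋉ʰ {1}` has integer coordinates. -/
theorem scaledExt_singleton_integral {n : ℕ} (S : Set (Fin n → ℝ)) (hSfin : S.Finite)
    (h : (Fin n → ℝ) → ℝ) (haff : IsAffineFn h)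
    (hnn : ∀ x ∈ convexHull ℝ S, 0 ≤ h x)
    (hint : ∀ x ∈ (convexHull ℝ S).extremePoints ℝ, ∀ i, ∃ z : ℤ, x i = (z : ℝ))
    (hhint : ∀ x ∈ (convexHull ℝ S).extremePoints ℝ, ∃ z : ℤ, h x = (z : ℝ)) :
    ∀ p ∈ ({p : (Fin n → ℝ) × ℝ | ∃ x ∈ convexHull ℝ S, p = (x, h x)}.extremePoints ℝ),
      (∀ i, ∃ z : ℤ, p.1 i = (z : ℝ)) ∧ ∃ z : ℤ, p.2 = (z : ℝ) := by
  intro p hp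
  obtain ⟨x, hx, rfl⟩ := haff.exists_mem_extremePoints_of_graph hp
  exact ⟨hint x hx, hhint x hx⟩
end

section
/- Consider a two-player extensive-form game (as in the model below) satisfying perfect recall that is triangle-free. Let (σ₁, σ₂) ∈ Σ₁ ⇌ Σ₂ be a relevant sequence pair, and let I₁ ∈ 𝓘₁ and I₂ ∈ 𝓘₂ be such that I₁ ⇌ I₂, σ(I₁) = σ₁, and σ(I₂) = σ₂. Then at most one of the following two quantities is strictly larger than 1: the σ₁-rank of I₂ and the σ₂-rank of I₁. -/
open scoped Classical

/-- A subtype with more than one element has an element different from any given one. -/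
theorem exists_ne_of_one_lt_card_subtype {α : Type*} {p : α → Prop}
    (h : 1 < Nat.card {x // p x}) (a : α) : ∃ b, p b ∧ b ≠ a := by
  have : Finite {x // p x} := Nat.finite_of_card_ne_zero (by omega)
  have : Nontrivial {x // p x} := Finite.one_lt_card_iff_nontrivial.mp h
  obtain ⟨x, y, hxy⟩ := exists_pair_ne {x // p x}
  by_cases hx : x.1 = a
  · exact ⟨y.1, y.2, fun hy => hxy (Subtype.ext (hx.trans hy.symm))⟩
  · exact ⟨x.1, x.2, hx⟩

/-- In a two-player perfect-recall triangle-free extensive-form game,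
for any relevant sequence pair `(σ₁, σ₂)` and connected information sets `I₁ ⇌ I₂` with
`σ(I₁) = σ₁` and `σ(I₂) = σ₂`, at most one of the `σ₁`-rank of `I₂` and the `σ₂`-rank
of `I₁` is strictly larger than `1`. -/
theorem rank_le_one_of_triangleFree (G : EFG) (hpr : G.PerfectRecall)
    (htf : G.TriangleFree) (σ₁ σ₂ : SeqP) (hrel : G.RelPair σ₁ σ₂)
    (I₁ I₂ : Set (List ℕ)) (hI₁ : G.InfoSet 0 I₁) (hI₂ : G.InfoSet 1 I₂)
    (hconn : Connected I₁ I₂) (hp₁ : G.parentSeq 0 I₁ = σ₁)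
    (hp₂ : G.parentSeq 1 I₂ = σ₂) :
    ¬ (1 < G.rank₁ σ₁ I₂ ∧ 1 < G.rank₂ σ₂ I₁) := by
  rintro ⟨h₁, h₂⟩
  obtain ⟨J, ⟨hJ, hJI, hJp⟩, hJne⟩ := exists_ne_of_one_lt_card_subtype h₁ I₁
  obtain ⟨K, ⟨hK, hIK, hKp⟩, hKne⟩ := exists_ne_of_one_lt_card_subtype h₂ I₂
  exact htf ⟨I₁, J, K, I₂, hI₁, hJ, hK, hI₂, hJne.symm, hKne, hp₁.trans hJp.symm,
    hKp.trans hp₂.symm, hIK, hJI, hconn⟩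
end
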